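/- arXiv:math/9703221 — 4 statements merged into one kernel-verified Lean document; each statement's English description precedes it below -/
import Mathlib

section
/- Let R be a commutative integral domain whose lattice of ideals contains no subset order-isomorphic to the power set of omega (this holds whenever R has Krull dimension in the sense of Gordon and Robson). Then the following are equivalent: (1) R is weakly productively bounded; (2) R is productively bounded; (3) L_R is transversally bounded; (4) L_R is uniformly transversally bounded; (5) for every uncountable family A of ideals of R whose intersection is zero, there is a countable subfamily A' of A whose intersection is zero. -/
universe u v w

/-- A commutative integral domain `R` is *weakly productively bounded* if, for every family
`(M i)_{i : I}` of `R`-modules whose direct product is a torsion module, the annihilator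
`ann_R (M i)` is nonzero for all but finitely many `i`. -/
def WeaklyProductivelyBounded (R : Type u) [CommRing R] [IsDomain R] : Prop :=
  ∀ (I : Type v) (M : I → Type w) [∀ i, AddCommGroup (M i)] [∀ i, Module R (M i)],
    Module.IsTorsion R (∀ i, M i) →
      {i : I | Module.annihilator R (M i) = ⊥}.Finite

/-- A commutative integral domain `R` is *productively bounded* if, for every family
`(M i)_{i : I}` of `R`-modules whose direct product is a torsion module, there is a
cofinite subset `J` of `I` such that the intersection of the annihilators
`ann_R (M i)`, for `i ∈ J`, is nonzero. -/
def ProductivelyBounded (R : Type u) [CommRing R] [IsDomain R] : Prop :=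
  ∀ (I : Type v) (M : I → Type w) [∀ i, AddCommGroup (M i)] [∀ i, Module R (M i)],
    Module.IsTorsion R (∀ i, M i) →
      ∃ J : Set I, Jᶜ.Finite ∧ (⨅ i ∈ J, Module.annihilator R (M i)) ≠ ⊥

/-- The dual ideal lattice `L_R` of a domain `R` is *transversally bounded* if for every
family `(X i)_{i : I}` of nonempty sets of ideals of `R`, all of whose transversals have
nonzero intersection, the intersection of all ideals in `X i` is nonzero for all but
finitely many `i`.  (Joins in `L_R` are intersections of ideals, and the top element of
`L_R` is the zero ideal, so this is transversal boundedness of the lattice `L_R`.) -/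
def IdealTB (R : Type u) [CommRing R] [IsDomain R] : Prop :=
  ∀ (I : Type v) (X : I → Set (Ideal R)), (∀ i, (X i).Nonempty) →
    (∀ A : I → Ideal R, (∀ i, A i ∈ X i) → (⨅ i, A i) ≠ ⊥) →
      {i : I | sInf (X i) = ⊥}.Finite

/-- The dual ideal lattice `L_R` of a domain `R` is *uniformly transversally bounded* if
for every family `(X i)_{i : I}` of nonempty sets of ideals of `R`, all of whose
transversals have nonzero intersection, there is a cofinite subset `J` of `I` such that
the intersection of all the ideals in `⋃ i ∈ J, X i` is nonzero. -/
def IdealUTB (R : Type u) [CommRing R] [IsDomain R] : Prop :=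
  ∀ (I : Type v) (X : I → Set (Ideal R)), (∀ i, (X i).Nonempty) →
    (∀ A : I → Ideal R, (∀ i, A i ∈ X i) → (⨅ i, A i) ≠ ⊥) →
      ∃ J : Set I, Jᶜ.Finite ∧ sInf (⋃ i ∈ J, X i) ≠ ⊥

/-- In a domain, two nonzero ideals have nonzero intersection. -/
theorem Ideal.inf_ne_bot_of_isDomain {R : Type*} [CommRing R] [IsDomain R] {I J : Ideal R}
    (hI : I ≠ ⊥) (hJ : J ≠ ⊥) : I ⊓ J ≠ ⊥ := by
  obtain ⟨x, hx, hx0⟩ := Submodule.exists_mem_ne_zero_of_ne_bot hI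
  obtain ⟨y, hy, hy0⟩ := Submodule.exists_mem_ne_zero_of_ne_bot hJ
  intro h
  have hxy : x * y ∈ I ⊓ J := ⟨I.mul_mem_right y hx, J.mul_mem_left x hy⟩
  rw [h, Ideal.mem_bot] at hxy
  exact mul_ne_zero hx0 hy0 hxy

/-- An infinite irredundant sequence of ideals yields a copy of the power set of `ℕ`. -/
theorem exists_powerset_embedding_of_irredundant {R : Type*} [CommRing R]
    (a : ℕ → Ideal R) (c : ℕ → R) (hc : ∀ i, c i ∉ a i) (hca : ∀ i j, i ≠ j → c i ∈ a j) :
    ∃ f : Set ℕ → Ideal R, Function.Injective f ∧ ∀ A B : Set ℕ, A ⊆ B ↔ f A ≤ f B := by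
  have key : ∀ A B : Set ℕ, A ⊆ B ↔ (⨅ n ∈ Aᶜ, a n) ≤ ⨅ n ∈ Bᶜ, a n := by
    intro A B
    refine ⟨fun h => biInf_mono fun n hn hA => hn (h hA), fun h n hnA => ?_⟩
    by_contra hnB
    refine hc n ((h.trans (biInf_le a hnB)) ?_)
    simp only [Submodule.mem_iInf]
    intro m hm
    exact hca n m (by rintro rfl; exact hm hnA)
  refine ⟨fun A => ⨅ n ∈ Aᶜ, a n, fun A B h => ?_, key⟩
  exact Set.Subset.antisymm ((key A B).2 (le_of_eq h)) ((key B A).2 (le_of_eq h.symm))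

/-- If all transversals of a sequence of countable sets of ideals with zero intersection are
nonzero, then for each `n` and each nonzero ideal `I` there are `a ∈ X n` and an infinite set
`N' ⊆ N` over which every transversal has a common element in `I \ a`. -/
theorem exists_transversals_meet_diff {R : Type*} [CommRing R] [IsDomain R]
    {X : ℕ → Set (Ideal R)} (hcount : ∀ n, (X n).Countable) (hzero : ∀ n, sInf (X n) = ⊥)
    (htrans : ∀ t : ℕ → Ideal R, (∀ n, t n ∈ X n) → (⨅ n, t n) ≠ ⊥)
    {I : Ideal R} (hI : I ≠ ⊥) {N : Set ℕ} (hN : N.Infinite) (n : ℕ) :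
    ∃ a ∈ X n, ∃ N' ⊆ N, N'.Infinite ∧ ∀ t : ℕ → Ideal R, (∀ m, t m ∈ X m) →
      ∃ c ∈ I, c ∉ a ∧ ∀ m ∈ N', c ∈ t m := by
  by_contra! hcon
  have hne : (X n).Nonempty := by
    by_contra! h
    have := hzero n
    simp [h] at this
  obtain ⟨e, he⟩ := (hcount n).exists_eq_range hne
  have heX : ∀ i, e i ∈ X n := fun i => he ▸ Set.mem_range_self i
  let f := hN.natEmbedding
  have hf : Function.Injective fun k => (f k : ℕ) :=
    Subtype.val_injective.comp f.injective
  let P : ℕ → Set ℕ := fun i => Set.range fun m => (f (Nat.pair i m) : ℕ)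
  have hPN : ∀ i, P i ⊆ N := by
    rintro i _ ⟨m, rfl⟩
    exact (f _).2
  have hPinf : ∀ i, (P i).Infinite := fun i =>
    Set.infinite_range_of_injective fun m m' h => by
      have := hf h
      simpa using this
  choose t htX ht using fun i => hcon (e i) (heX i) (P i) (hPN i) (hPinf i)
  let g : ℕ → ℕ := fun k => (Nat.unpair (Function.invFun (fun k => (f k : ℕ)) k)).1
  have hg : ∀ i, ∀ k ∈ P i, g k = i := by
    rintro i _ ⟨m, rfl⟩
    have := Function.leftInverse_invFun hf (Nat.pair i m)
    simp only [g]
    rw [this, Nat.unpair_pair]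
  obtain ⟨c, hc, hc0⟩ := Submodule.exists_mem_ne_zero_of_ne_bot
    (Ideal.inf_ne_bot_of_isDomain hI (htrans (fun k => t (g k) k) fun k => htX _ k))
  have hcn : c ∉ sInf (X n) := by
    rw [hzero n]
    simpa using hc0
  simp only [Submodule.mem_sInf, not_forall] at hcn
  obtain ⟨a, ha, hca⟩ := hcn
  rw [he] at ha
  obtain ⟨i, rfl⟩ := ha
  obtain ⟨k, hk, hck⟩ := ht i c hc.1 hca
  have := (Submodule.mem_iInf _).1 hc.2 k
  simp only [hg i k hk] at this
  exact hck this

/-- If the ideal lattice contains no copy of the power set of `ℕ`, every sequence of countable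
sets of ideals with zero intersection has a transversal with zero intersection. -/
theorem exists_transversal_iInf_eq_bot {R : Type*} [CommRing R] [IsDomain R]
    (hR : ¬ ∃ f : Set ℕ → Ideal R, Function.Injective f ∧
      ∀ A B : Set ℕ, A ⊆ B ↔ f A ≤ f B)
    (X : ℕ → Set (Ideal R)) (hcount : ∀ n, (X n).Countable) (hzero : ∀ n, sInf (X n) = ⊥) :
    ∃ t : ℕ → Ideal R, (∀ n, t n ∈ X n) ∧ (⨅ n, t n) = ⊥ := by
  by_contra! htrans
  have hne : ∀ n, (X n).Nonempty := by
    intro n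
    by_contra! h
    have := hzero n
    simp [h] at this
  choose d hd using hne
  have hX0 : ∀ n, ∀ a ∈ X n, a ≠ ⊥ := by
    rintro n a ha rfl
    refine htrans (Function.update d n ⊥) (fun m => ?_) ?_
    · rcases eq_or_ne m n with rfl | hmn
      · simpa using ha
      · simpa [hmn] using hd m
    · exact le_bot_iff.1 ((iInf_le _ n).trans (by simp))
  let S := {p : Ideal R × Set ℕ // p.1 ≠ ⊥ ∧ p.2.Infinite}
  have hstep : ∀ p : S, ∃ (q : S) (n : ℕ) (a : Ideal R), n ∈ p.1.2 ∧ a ∈ X n ∧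
      q.1.1 = p.1.1 ⊓ a ∧ q.1.2 ⊆ p.1.2 \ {n} ∧
      ∀ t : ℕ → Ideal R, (∀ m, t m ∈ X m) →
        ∃ c ∈ p.1.1, c ∉ a ∧ ∀ m ∈ q.1.2, c ∈ t m := by
    rintro ⟨⟨I, N⟩, hI, hN⟩
    obtain ⟨n, hn⟩ := hN.nonempty
    obtain ⟨a, ha, N', hN', hinf, h⟩ := exists_transversals_meet_diff hcount hzero htrans hI
      (hN.sdiff (Set.finite_singleton n)) n
    exact ⟨⟨(I ⊓ a, N'), Ideal.inf_ne_bot_of_isDomain hI (hX0 n a ha), hinf⟩, n, a, hn, ha,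
      rfl, hN', h⟩
  choose q n a hn ha hq1 hq2 hq3 using hstep
  let s : ℕ → S := fun i => Nat.rec ⟨(⊤, Set.univ), top_ne_bot, Set.infinite_univ⟩
    (fun _ p => q p) i
  have hs : ∀ i, s (i + 1) = q (s i) := fun i => rfl
  have hanti1 : Antitone fun i => (s i).1.1 := antitone_nat_of_succ_le fun i => by
    simp only [hs, hq1]
    exact inf_le_left
  have hanti2 : Antitone fun i => (s i).1.2 := antitone_nat_of_succ_le fun i => by
    simp only [hs]
    exact (hq2 _).trans Set.sdiff_subset
  have hlater : ∀ i j, i < j → n (s j) ∈ (s (i + 1)).1.2 := fun i j hij =>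
    hanti2 (Nat.succ_le_of_lt hij) (hn (s j))
  have hne' : ∀ i j, i < j → n (s i) ≠ n (s j) := fun i j hij h => by
    have := hlater i j hij
    rw [hs] at this
    exact (hq2 _ this).2 h.symm
  have hinj : Function.Injective fun i => n (s i) := by
    intro i j h
    rcases lt_trichotomy i j with hij | hij | hij
    · exact absurd h (hne' i j hij)
    · exact hij
    · exact absurd h.symm (hne' j i hij)
  let t : ℕ → Ideal R := Function.extend (fun i => n (s i)) (fun i => a (s i)) d
  have ht : ∀ i, t (n (s i)) = a (s i) := fun i => hinj.extend_apply _ _ i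
  have htX : ∀ m, t m ∈ X m := by
    intro m
    by_cases hm : ∃ i, n (s i) = m
    · obtain ⟨i, rfl⟩ := hm
      rw [ht]
      exact ha _
    · rw [show t m = d m from Function.extend_apply' _ _ _ hm]
      exact hd m
  choose c hc1 hc2 hc3 using fun i => hq3 (s i) t htX
  refine hR (exists_powerset_embedding_of_irredundant (fun i => a (s i)) c hc2 fun i j hij => ?_)
  rcases lt_or_gt_of_ne hij with h | h
  · rw [← ht j]
    exact hc3 i _ (hlater i j h)
  · have h1 : c i ∈ (s (j + 1)).1.1 := hanti1 (Nat.succ_le_of_lt h) (hc1 i)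
    rw [hs, hq1] at h1
    exact h1.2

/-- The ideal of those elements lying in `B i` for all but finitely many `i ∈ N`. -/
def tailIdeal {R ι : Type*} [CommRing R] (B : ι → Ideal R) (N : Set ι) : Ideal R where
  carrier := {c | {i ∈ N | c ∉ B i}.Finite}
  zero_mem' := by simp
  add_mem' {x y} hx hy := (hx.union hy).subset fun i hi => by
    by_contra h
    simp only [Set.mem_union, Set.mem_ofPred_eq, not_or, not_and, not_not] at h
    exact hi.2 ((B i).add_mem (h.1 hi.1) (h.2 hi.1))
  smul_mem' r x hx := hx.subset fun i hi => ⟨hi.1, fun h => hi.2 ((B i).mul_mem_left r h)⟩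

theorem mem_tailIdeal {R ι : Type*} [CommRing R] {B : ι → Ideal R} {N : Set ι} {c : R} :
    c ∈ tailIdeal B N ↔ {i ∈ N | c ∉ B i}.Finite := Iff.rfl

theorem tailIdeal_le_of_diff_finite {R ι : Type*} [CommRing R] (B : ι → Ideal R) {M N : Set ι}
    (h : (M \ N).Finite) : tailIdeal B N ≤ tailIdeal B M := fun c hc =>
  ((mem_tailIdeal.1 hc).union h).subset fun i hi => by
    by_cases hN : i ∈ N
    · exact Or.inl ⟨hN, hi.2⟩
    · exact Or.inr ⟨hi.1, hN⟩

theorem biInf_le_tailIdeal {R ι : Type*} [CommRing R] (B : ι → Ideal R) (N : Set ι) :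
    (⨅ i ∈ N, B i) ≤ tailIdeal B N := fun c hc => by
  simp only [Submodule.mem_iInf] at hc
  rw [mem_tailIdeal]
  convert Set.finite_empty (α := ι)
  ext i
  simpa using hc i

/-- If zero intersections of ideals are witnessed by countable subfamilies, then a countably
directed family of nonzero ideals has nonzero intersection. -/
theorem iInf_ne_bot_of_countably_directed {R κ : Type*} [CommRing R] [IsDomain R]
    (hcount : ∀ A : Set (Ideal R), sInf A = ⊥ → ∃ A' ⊆ A, A'.Countable ∧ sInf A' = ⊥)
    (D : κ → Ideal R) (hD : ∀ k, D k ≠ ⊥) (hdir : ∀ s : ℕ → κ, ∃ k, ∀ n, D k ≤ D (s n)) :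
    (⨅ k, D k) ≠ ⊥ := by
  intro h
  obtain ⟨A, hA, hAc, hA0⟩ := hcount (Set.range D) (by rwa [sInf_range])
  have hne : A.Nonempty := by
    by_contra! h
    simp [h] at hA0
  obtain ⟨f, rfl⟩ := hAc.exists_eq_range hne
  choose s hs using fun n => hA (Set.mem_range_self n)
  obtain ⟨k, hk⟩ := hdir s
  refine hD k (le_bot_iff.1 ?_)
  rw [← hA0, sInf_range]
  exact le_iInf fun n => (hk n).trans (hs n).le

theorem biInf_union_ne_bot {R ι : Type*} [CommRing R] [IsDomain R] {B : ι → Ideal R}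
    {M N : Set ι} (hM : (⨅ i ∈ M, B i) ≠ ⊥) (hN : (⨅ i ∈ N, B i) ≠ ⊥) :
    (⨅ i ∈ M ∪ N, B i) ≠ ⊥ := by
  rw [iInf_union]
  exact Ideal.inf_ne_bot_of_isDomain hM hN

theorem biInf_ne_bot_mono {R ι : Type*} [CommRing R] {B : ι → Ideal R}
    {M N : Set ι} (h : M ⊆ N) (hN : (⨅ i ∈ N, B i) ≠ ⊥) : (⨅ i ∈ M, B i) ≠ ⊥ := fun h0 =>
  hN (le_bot_iff.1 (h0 ▸ biInf_mono h))

theorem biInf_ne_bot_of_finite {R ι : Type*} [CommRing R] [IsDomain R] {B : ι → Ideal R}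
    {N : Set ι} (hN : N.Finite) (h : ∀ i ∈ N, B i ≠ ⊥) : (⨅ i ∈ N, B i) ≠ ⊥ := by
  induction N, hN using Set.Finite.induction_on with
  | empty => simp
  | @insert a s _ _ ih =>
    rw [iInf_insert]
    exact Ideal.inf_ne_bot_of_isDomain (h a (by simp)) (ih fun i hi => h i (by simp [hi]))

/-- If zero intersections are witnessed by countable subfamilies, the sets of indices with
nonzero intersection cannot form a nonprincipal maximal ideal of sets. -/
theorem biInf_ne_bot_of_forall_or {R ι : Type*} [CommRing R] [IsDomain R]
    (hcount : ∀ A : Set (Ideal R), sInf A = ⊥ → ∃ A' ⊆ A, A'.Countable ∧ sInf A' = ⊥)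
    (B : ι → Ideal R) (V : Set ι) (hB : ∀ i ∈ V, B i ≠ ⊥)
    (hV : ∀ W ⊆ V, (⨅ i ∈ W, B i) ≠ ⊥ ∨ (⨅ i ∈ V \ W, B i) ≠ ⊥) :
    (⨅ i ∈ V, B i) ≠ ⊥ := by
  intro hbig
  have tail_ne : ∀ N : Set ι, (⨅ i ∈ N, B i) ≠ ⊥ → tailIdeal B N ≠ ⊥ := fun N hN h =>
    hN (le_bot_iff.1 (h ▸ biInf_le_tailIdeal B N))
  have mem_small : ∀ (c : R) (N : Set ι), c ≠ 0 → (∀ i ∈ N, c ∈ B i) → (⨅ i ∈ N, B i) ≠ ⊥ := by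
    intro c N hc h h0
    have : c ∈ ⨅ i ∈ N, B i := by simpa only [Submodule.mem_iInf] using h
    rw [h0] at this
    exact hc (by simpa using this)
  let K := {N : Set ι // N ⊆ V ∧ (⨅ i ∈ N, B i) ≠ ⊥}
  have hK : (⨅ N : K, tailIdeal B N.1) = ⊥ := by
    refine (Submodule.eq_bot_iff _).2 fun c hc => ?_
    by_contra hc0
    have hZ : {i ∈ V | c ∉ B i}.Infinite := by
      intro hfin
      refine biInf_union_ne_bot (mem_small c {i ∈ V | c ∈ B i} hc0 fun i hi => hi.2)
        (biInf_ne_bot_of_finite hfin fun i hi => hB i hi.1) ?_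
      rw [← hbig]
      congr 1
      ext i
      by_cases h : c ∈ B i <;> simp [h]
    obtain ⟨Z, hZsub, hZ1, hZ2⟩ : ∃ Z ⊆ {i ∈ V | c ∉ B i}, Z.Infinite ∧
        ({i ∈ V | c ∉ B i} \ Z).Infinite := by
      let f := hZ.natEmbedding
      have hf : Function.Injective fun k => (f k : ι) :=
        Subtype.val_injective.comp f.injective
      refine ⟨Set.range fun k => (f (2 * k) : ι), ?_, ?_, ?_⟩
      · rintro _ ⟨k, rfl⟩
        exact (f _).2
      · exact Set.infinite_range_of_injective fun k l h => by
          have := hf h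
          omega
      · refine (Set.infinite_range_of_injective (f := fun k => (f (2 * k + 1) : ι))
          fun k l h => ?_).mono ?_
        · have := hf h
          omega
        · rintro _ ⟨k, rfl⟩
          refine ⟨(f _).2, ?_⟩
          rintro ⟨l, hl⟩
          have := hf hl
          omega
    have hcon : ∀ N ⊆ {i ∈ V | c ∉ B i}, N.Infinite → (⨅ i ∈ N, B i) ≠ ⊥ → False := by
      intro N hN hinf hsmall
      have := (Submodule.mem_iInf _).1 hc ⟨N, fun i hi => (hN hi).1, hsmall⟩
      rw [mem_tailIdeal] at this
      exact hinf (this.subset fun i hi => ⟨hi, (hN hi).2⟩)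
    rcases hV Z fun i hi => (hZsub hi).1 with h | h
    · exact hcon Z hZsub hZ1 h
    · exact hcon _ Set.sdiff_subset hZ2
        (biInf_ne_bot_mono (Set.sdiff_subset_sdiff_left fun i hi => hi.1) h)
  obtain ⟨s, hs⟩ : ∃ s : ℕ → K, ∀ N : K, ∃ n, ¬ tailIdeal B N.1 ≤ tailIdeal B (s n).1 := by
    by_contra! h
    exact iInf_ne_bot_of_countably_directed hcount (fun N : K => tailIdeal B N.1)
      (fun N => tail_ne _ N.2.2) h hK
  let U : Set ι := ⋃ n, (s n).1
  have hUV : U ⊆ V := Set.iUnion_subset fun n => (s n).2.1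
  have hU : (⨅ i ∈ U, B i) = ⊥ := by
    by_contra h
    obtain ⟨n, hn⟩ := hs ⟨U, hUV, h⟩
    refine hn (tailIdeal_le_of_diff_finite B ?_)
    rw [Set.sdiff_eq_empty.2 (Set.subset_iUnion (fun n => (s n).1) n)]
    exact Set.finite_empty
  let L := {N : Set ι // N ⊆ U ∧ ∀ n, (N ∩ (s n).1).Finite}
  have hL : ∀ N : L, (⨅ i ∈ N.1, B i) ≠ ⊥ := by
    rintro ⟨N, hNU, hN⟩
    refine (hV N (hNU.trans hUV)).resolve_right fun h => ?_
    obtain ⟨n, hn⟩ := hs ⟨V \ N, Set.sdiff_subset, h⟩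
    refine hn (tailIdeal_le_of_diff_finite B ((hN n).subset ?_))
    rintro i ⟨hi, hiN⟩
    refine ⟨?_, hi⟩
    by_contra h'
    exact hiN ⟨(s n).2.1 hi, h'⟩
  have hLinf : (⨅ N : L, tailIdeal B N.1) ≠ ⊥ := by
    refine iInf_ne_bot_of_countably_directed hcount _ (fun N => tail_ne _ (hL N)) fun r => ?_
    refine ⟨⟨⋃ k, (r k).1 \ ⋃ j ∈ Set.Iic k, (s j).1, ?_, fun n => ?_⟩, fun k => ?_⟩
    · exact Set.iUnion_subset fun k => Set.sdiff_subset.trans (r k).2.1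
    · refine ((Set.finite_Iio n).biUnion fun k _ => (r k).2.2 n).subset ?_
      rintro i ⟨hi, hin⟩
      obtain ⟨k, hik, hk⟩ := Set.mem_iUnion.1 hi
      refine Set.mem_biUnion (x := k) ?_ ⟨hik, hin⟩
      by_contra hkn
      exact hk (Set.mem_biUnion (x := n) (Set.mem_Iic.2 (by simpa using hkn)) hin)
    · refine tailIdeal_le_of_diff_finite B
        (((Set.finite_Iic k).biUnion fun j _ => (r k).2.2 j).subset ?_)
      rintro i ⟨hi, hi'⟩
      by_contra h
      refine hi' (Set.mem_iUnion.2 ⟨k, hi, fun h' => h ?_⟩)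
      obtain ⟨j, hj, hij⟩ := Set.mem_iUnion₂.1 h'
      exact Set.mem_biUnion hj ⟨hi, hij⟩
  obtain ⟨c, hc, hc0⟩ := Submodule.exists_mem_ne_zero_of_ne_bot hLinf
  by_cases hZ : ∃ n, {i ∈ U | c ∉ B i} ⊆ ⋃ j ∈ Set.Iio n, (s j).1
  · obtain ⟨n, hn⟩ := hZ
    have hfin : ∀ n, (⨅ i ∈ ⋃ j ∈ Set.Iio n, (s j).1, B i) ≠ ⊥ := by
      intro n
      rw [iInf_iUnion]
      simp_rw [iInf_iUnion]
      exact biInf_ne_bot_of_finite (Set.finite_Iio n) fun j _ => (s j).2.2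
    refine biInf_ne_bot_mono ?_ (biInf_union_ne_bot
      (mem_small c {i ∈ U | c ∈ B i} hc0 fun i hi => hi.2) (hfin n)) hU
    intro i hi
    by_cases h : c ∈ B i
    · exact Or.inl ⟨hi, h⟩
    · exact Or.inr (hn ⟨hi, h⟩)
  · push Not at hZ
    choose z hz hz' using fun n => Set.not_subset.1 (hZ n)
    have hfin : ∀ n, (Set.range z ∩ (s n).1).Finite := by
      intro n
      refine ((Set.finite_Iic n).image z).subset ?_
      rintro _ ⟨⟨k, rfl⟩, hk⟩
      refine ⟨k, ?_, rfl⟩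
      by_contra hkn
      exact hz' k (Set.mem_biUnion (x := n) (Set.mem_Iio.2 (by simpa using hkn)) hk)
    have hmem := (Submodule.mem_iInf _).1 hc
      ⟨Set.range z, by rintro _ ⟨k, rfl⟩; exact (hz k).1, hfin⟩
    rw [mem_tailIdeal] at hmem
    have hrange : (Set.range z).Finite := hmem.subset (by
      rintro _ ⟨k, rfl⟩
      exact ⟨⟨k, rfl⟩, (hz k).2⟩)
    choose! m hm using fun (v : ι) (hv : v ∈ U) => Set.mem_iUnion.1 hv
    obtain ⟨b, hb⟩ := (hrange.image m).bddAbove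
    refine hz' (b + 1) (Set.mem_biUnion (x := m (z (b + 1))) ?_ (hm _ (hz _).1))
    exact Set.mem_Iio.2 (Nat.lt_succ_of_le (hb (Set.mem_image_of_mem m ⟨_, rfl⟩)))

/-- If zero intersections are witnessed by countable subfamilies and there is no sequence of
disjoint sets of indices with zero intersection, then some cofinite set of indices has nonzero
intersection. -/
theorem exists_cofinite_biInf_ne_bot {R ι : Type*} [CommRing R] [IsDomain R]
    (hcount : ∀ A : Set (Ideal R), sInf A = ⊥ → ∃ A' ⊆ A, A'.Countable ∧ sInf A' = ⊥)
    (B : ι → Ideal R)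
    (hd : ¬ ∃ J : ℕ → Set ι, (∀ m n, m < n → Disjoint (J m) (J n)) ∧
      ∀ n, (⨅ i ∈ J n, B i) = ⊥) :
    ∃ J : Set ι, Jᶜ.Finite ∧ (⨅ i ∈ J, B i) ≠ ⊥ := by
  by_contra! hcon
  have hE : {i | B i = ⊥}.Finite := by
    by_contra hinf
    let f := Set.Infinite.natEmbedding _ hinf
    refine hd ⟨fun n => {(f n : ι)}, fun m n hmn => ?_, fun n => ?_⟩
    · rw [Set.disjoint_singleton]
      exact fun h => hmn.ne (f.injective (Subtype.ext h))
    · rw [iInf_singleton]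
      exact (f n).2
  by_cases hsplit : ∀ V ⊆ {i | B i = ⊥}ᶜ, (⨅ i ∈ V, B i) = ⊥ →
      ∃ W ⊆ V, (⨅ i ∈ W, B i) = ⊥ ∧ (⨅ i ∈ V \ W, B i) = ⊥
  · let T := {V : Set ι // V ⊆ {i | B i = ⊥}ᶜ ∧ (⨅ i ∈ V, B i) = ⊥}
    have hT : ∀ V : T, ∃ W : T, W.1 ⊆ V.1 ∧ (⨅ i ∈ V.1 \ W.1, B i) = ⊥ := by
      rintro ⟨V, hVE, hV⟩
      obtain ⟨W, hWV, hW, hVW⟩ := hsplit V hVE hV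
      exact ⟨⟨W, hWV.trans hVE, hW⟩, hWV, hVW⟩
    choose q hq1 hq2 using hT
    let s : ℕ → T := fun n => Nat.rec
      ⟨{i | B i = ⊥}ᶜ, subset_rfl, hcon _ (by rwa [compl_compl])⟩ (fun _ => q) n
    have hanti : Antitone fun n => (s n).1 := antitone_nat_of_succ_le fun n => hq1 (s n)
    refine hd ⟨fun n => (s n).1 \ (s (n + 1)).1, fun m n hmn => ?_, fun n => hq2 (s n)⟩
    exact Set.disjoint_left.2 fun i hi hi' => hi.2 (hanti (Nat.succ_le_of_lt hmn) hi'.1)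
  · push Not at hsplit
    obtain ⟨V, hVE, hV, hVW⟩ := hsplit
    exact biInf_ne_bot_of_forall_or hcount B V (fun i hi => hVE hi)
      (fun W hW => or_iff_not_imp_left.2 fun h => hVW W hW (not_not.1 h)) hV

theorem sInf_biUnion {α ι : Type*} [CompleteLattice α] (X : ι → Set α) (J : Set ι) :
    sInf (⋃ i ∈ J, X i) = ⨅ i ∈ J, sInf (X i) := by
  simp_rw [sInf_eq_iInf, iInf_iUnion]

/-- If the ideal lattice contains no copy of the power set of `ℕ` and zero intersections are
witnessed by countable subfamilies, then the ideal lattice is uniformly transversally bounded. -/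
theorem idealUTB_of_countable (R : Type u) [CommRing R] [IsDomain R]
    (hR : ¬ ∃ f : Set ℕ → Ideal R, Function.Injective f ∧
      ∀ A B : Set ℕ, A ⊆ B ↔ f A ≤ f B)
    (hcount : ∀ A : Set (Ideal R), sInf A = ⊥ → ∃ A' ⊆ A, A'.Countable ∧ sInf A' = ⊥) :
    IdealUTB.{u, v} R := by
  intro I X hne htrans
  simp_rw [sInf_biUnion]
  refine exists_cofinite_biInf_ne_bot hcount _ ?_
  rintro ⟨J, hJ, hJ0⟩
  choose Y hYX hYc hY0 using fun n => hcount (⋃ i ∈ J n, X i) (by rw [sInf_biUnion, hJ0])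
  obtain ⟨t, ht, ht0⟩ := exists_transversal_iInf_eq_bot hR Y hYc hY0
  have hi : ∀ n, ∃ i ∈ J n, t n ∈ X i := fun n => by
    simpa using hYX n (ht n)
  choose i hiJ hiX using hi
  choose d hd using hne
  have hinj : Function.Injective i := by
    intro m n h
    rcases lt_trichotomy m n with hmn | hmn | hmn
    · exact absurd (h ▸ hiJ n) (Set.disjoint_left.1 (hJ m n hmn) (hiJ m))
    · exact hmn
    · exact absurd (h ▸ hiJ m) (Set.disjoint_left.1 (hJ n m hmn) (hiJ n))
  refine htrans (Function.extend i t d) (fun j => ?_) (le_bot_iff.1 (ht0 ▸ le_iInf fun n => ?_))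
  · by_cases hj : ∃ n, i n = j
    · obtain ⟨n, rfl⟩ := hj
      rw [hinj.extend_apply]
      exact hiX n
    · rw [Function.extend_apply' _ _ _ hj]
      exact hd j
  · exact (iInf_le _ (i n)).trans (hinj.extend_apply t d n).le

/-- The annihilator of a module is the intersection of the annihilators of its elements. -/
theorem sInf_range_torsionOf (R M : Type*) [CommRing R] [AddCommGroup M] [Module R M] :
    sInf (Set.range fun x : M => Ideal.torsionOf R M x) = Module.annihilator R M := by
  ext r
  simp [Submodule.mem_sInf, Module.mem_annihilator]

/-- If a product of modules is torsion, the transversals of the families of annihilators of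
elements have nonzero intersection. -/
theorem iInf_ne_bot_of_isTorsion_pi {R ι : Type*} [CommRing R] [IsDomain R] {M : ι → Type*}
    [∀ i, AddCommGroup (M i)] [∀ i, Module R (M i)] (h : Module.IsTorsion R (∀ i, M i))
    (A : ι → Ideal R) (hA : ∀ i, A i ∈ Set.range fun x : M i => Ideal.torsionOf R (M i) x) :
    (⨅ i, A i) ≠ ⊥ := by
  choose m hm using hA
  obtain ⟨c, hc⟩ := @h m
  intro h0
  have hmem : (c : R) ∈ ⨅ i, A i := by
    refine (Submodule.mem_iInf _).2 fun i => ?_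
    rw [← hm i]
    exact (Ideal.mem_torsionOf_iff _ _).2 (congrFun hc i)
  rw [h0, Ideal.mem_bot] at hmem
  exact nonZeroDivisors.coe_ne_zero c hmem

/-- A family of ideals with zero intersection, all of whose countable subfamilies have nonzero
intersection, contradicts weak productive boundedness. -/
theorem exists_countable_of_weaklyProductivelyBounded (R : Type u) [CommRing R] [IsDomain R]
    (hW : WeaklyProductivelyBounded.{u, v, u} R) (A : Set (Ideal R)) (hA : sInf A = ⊥) :
    ∃ A' ⊆ A, A'.Countable ∧ sInf A' = ⊥ := by
  classical
  by_contra! hcon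
  have hfin := hW (ULift.{v} ℕ) (fun _ => Π₀ a : A, R ⧸ a.1) fun x => by
    obtain ⟨c, hc, hc0⟩ := Submodule.exists_mem_ne_zero_of_ne_bot
      (hcon (⋃ n, Subtype.val '' ((x n).support : Set A))
        (Set.iUnion_subset fun n => by rintro _ ⟨a, -, rfl⟩; exact a.2)
        (Set.countable_iUnion fun n => (Finset.countable_toSet _).image _))
    refine ⟨⟨c, mem_nonZeroDivisors_of_ne_zero hc0⟩, ?_⟩
    ext n a : 2
    by_cases ha : x n a = 0
    · change c • x n a = 0
      rw [ha, smul_zero]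
    · have hca : c ∈ a.1 := (Submodule.mem_sInf.1 hc) a.1
        (Set.mem_iUnion.2 ⟨n, a, by simpa using ha, rfl⟩)
      change c • x n a = 0
      obtain ⟨y, hy⟩ := Ideal.Quotient.mk_surjective (x n a)
      rw [← hy]
      change Ideal.Quotient.mk a.1 (c * y) = 0
      exact Ideal.Quotient.eq_zero_iff_mem.2 (a.1.mul_mem_right y hca)
  refine Set.infinite_univ (α := ULift.{v} ℕ) (hfin.subset fun n _ => ?_)
  refine (Submodule.eq_bot_iff _).2 fun r hr => ?_
  have hrA : r ∈ sInf A := Submodule.mem_sInf.2 fun a ha => by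
    have h := DFunLike.congr_fun (Module.mem_annihilator.1 hr
      (DFinsupp.single (⟨a, ha⟩ : A) (Ideal.Quotient.mk a 1))) ⟨a, ha⟩
    rw [DFinsupp.smul_apply, DFinsupp.single_eq_same] at h
    have h' : Ideal.Quotient.mk a (r * 1) = 0 := h
    simpa using Ideal.Quotient.eq_zero_iff_mem.1 h'
  rw [hA] at hrA
  simpa using hrA

/-- Let `R` be a commutative integral domain whose lattice of ideals contains no subset
order-isomorphic to the power set of `ℕ` (this holds whenever `R` has Krull dimension in
the sense of Gordon and Robson).  Then the following are equivalent:
(1) `R` is weakly productively bounded;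
(2) `R` is productively bounded;
(3) `L_R` is transversally bounded;
(4) `L_R` is uniformly transversally bounded;
(5) for every uncountable family `A` of ideals of `R` whose intersection is zero, there
is a countable subfamily `A'` of `A` whose intersection is zero. -/
theorem krull_tfae (R : Type u) [CommRing R] [IsDomain R]
    (hR : ¬ ∃ f : Set ℕ → Ideal R, Function.Injective f ∧
      ∀ A B : Set ℕ, A ⊆ B ↔ f A ≤ f B) :
    List.TFAE
      [WeaklyProductivelyBounded.{u, u, u} R,
       ProductivelyBounded.{u, u, u} R,
       IdealTB.{u, u} R,
       IdealUTB.{u, u} R,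
       ∀ A : Set (Ideal R), ¬ A.Countable → sInf A = ⊥ →
         ∃ A' ⊆ A, A'.Countable ∧ sInf A' = ⊥] := by
  tfae_have 1 → 5 := fun h A _ hA => exists_countable_of_weaklyProductivelyBounded R h A hA
  tfae_have 5 → 4 := fun h => idealUTB_of_countable R hR fun A hA => by
    by_cases hc : A.Countable
    · exact ⟨A, subset_rfl, hc, hA⟩
    · exact h A hc hA
  tfae_have 4 → 3 := fun h I X hne htrans => by
    obtain ⟨J, hJ, hJ0⟩ := h I X hne htrans
    refine hJ.subset fun i hi hiJ => hJ0 (le_bot_iff.1 ?_)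
    rw [← show sInf (X i) = ⊥ from hi]
    exact sInf_le_sInf (Set.subset_biUnion_of_mem hiJ)
  tfae_have 3 → 1 := fun h I M _ _ htor => by
    have := h I (fun i => Set.range fun x : M i => Ideal.torsionOf R (M i) x)
      (fun i => Set.range_nonempty _) (iInf_ne_bot_of_isTorsion_pi htor)
    simpa only [sInf_range_torsionOf] using this
  tfae_have 4 → 2 := fun h I M _ _ htor => by
    have := h I (fun i => Set.range fun x : M i => Ideal.torsionOf R (M i) x)
      (fun i => Set.range_nonempty _) (iInf_ne_bot_of_isTorsion_pi htor)
    simpa only [sInf_biUnion, sInf_range_torsionOf] using this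
  tfae_have 2 → 1 := fun h I M _ _ htor => by
    obtain ⟨J, hJ, hJ0⟩ := h I M htor
    refine hJ.subset fun i hi hiJ => hJ0 (le_bot_iff.1 ?_)
    rw [← show Module.annihilator R (M i) = ⊥ from hi]
    exact biInf_le _ hiJ
  tfae_finish
end

section
/- Every commutative integral domain which is countably generated as a ring over a noetherian subring is productively bounded. -/
universe u v w

/-- In a noetherian local ring, an antitone family of ideals indexed by sets is stationary on
countable sets: it is so modulo each power of the maximal ideal, and Krull's intersection theorem
applies. -/
lemma IsLocalRing.exists_countable_le_of_antitone {B : Type*} [CommRing B] [IsNoetherianRing B]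
    [IsLocalRing B] {ι : Type*} (f : Set ι → Ideal B) (hf : Antitone f) :
    ∃ C : Set ι, C.Countable ∧ ∀ D : Set ι, D.Countable → C ⊆ D → f C ≤ f D := by
  have key (n : ℕ) : ∃ C : Set ι, C.Countable ∧ ∀ D : Set ι, D.Countable → C ⊆ D →
      f C ≤ f D ⊔ maximalIdeal B ^ n := by
    rcases Nat.eq_zero_or_pos n with rfl | hn
    · exact ⟨∅, Set.countable_empty, fun D _ _ => by simp⟩
    have hne : maximalIdeal B ^ n ≠ ⊤ := fun h =>
      (maximalIdeal.isMaximal B).ne_top (top_le_iff.mp (h ▸ Ideal.pow_le_self hn.ne'))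
    have : Nontrivial (B ⧸ maximalIdeal B ^ n) := Ideal.Quotient.nontrivial_iff.mpr hne
    have hloc : IsLocalRing (B ⧸ maximalIdeal B ^ n) :=
      IsLocalRing.of_surjective' (Ideal.Quotient.mk _) Ideal.Quotient.mk_surjective
    have : IsArtinianRing (B ⧸ maximalIdeal B ^ n) := by
      rw [isArtinianRing_iff_isNilpotent_maximalIdeal]
      refine ⟨n, ?_⟩
      have : IsLocalHom (Ideal.Quotient.mk (maximalIdeal B ^ n)) :=
        IsLocalHom.of_surjective _ Ideal.Quotient.mk_surjective
      have hmap : maximalIdeal (B ⧸ maximalIdeal B ^ n) ≤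
          (maximalIdeal B).map (Ideal.Quotient.mk _) := by
        intro y hy
        obtain ⟨y, rfl⟩ := Ideal.Quotient.mk_surjective y
        exact Ideal.mem_map_of_mem _ (by simpa using hy)
      rw [Ideal.zero_eq_bot, eq_bot_iff]
      refine (Ideal.pow_right_mono hmap n).trans ?_
      rw [← Ideal.map_pow, Ideal.map_quotient_self]
    obtain ⟨_, ⟨C, hC, rfl⟩, hmin⟩ := (wellFounded_lt (α := Ideal (B ⧸ maximalIdeal B ^ n))).has_min
      ((fun C => (f C).map (Ideal.Quotient.mk (maximalIdeal B ^ n))) '' {C : Set ι | C.Countable})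
      ⟨_, ∅, Set.countable_empty, rfl⟩
    refine ⟨C, hC, fun D hD hCD => ?_⟩
    have h := eq_of_le_of_not_lt (Ideal.map_mono (f := Ideal.Quotient.mk (maximalIdeal B ^ n))
      (hf hCD)) (hmin _ ⟨D, hD, rfl⟩)
    have h2 := Ideal.map_le_iff_le_comap.mp h.ge
    rwa [Ideal.comap_map_of_surjective _ Ideal.Quotient.mk_surjective, ← RingHom.ker_eq_comap_bot,
      Ideal.mk_ker] at h2
  choose C hC hCD using key
  refine ⟨⋃ n, C n, Set.countable_iUnion hC, fun D hD hsub x hx => ?_⟩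
  have hmem : Submodule.Quotient.mk x ∈
      (⨅ n : ℕ, maximalIdeal B ^ n • ⊤ : Submodule B (B ⧸ f D)) := by
    rw [Submodule.mem_iInf]
    intro n
    have hxn := hCD n D hD ((Set.subset_iUnion C n).trans hsub) (hf (Set.subset_iUnion C n) hx)
    obtain ⟨y, hy, z, hz, rfl⟩ := Submodule.mem_sup.mp hxn
    have : (Submodule.Quotient.mk (y + z) : B ⧸ f D) = z • Submodule.Quotient.mk 1 := by
      rw [← Submodule.Quotient.mk_smul, Submodule.Quotient.eq]
      simpa using hy
    rw [this]
    exact Submodule.smul_mem_smul hz trivial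
  rw [Ideal.iInf_pow_smul_eq_bot_of_isLocalRing _ (maximalIdeal.isMaximal B).ne_top] at hmem
  exact (Submodule.Quotient.mk_eq_zero _).mp hmem

lemma Ideal.not_colon_le_of_map_localization_le {A : Type*} [CommRing A] [IsNoetherianRing A]
    (q : Ideal A) [q.IsPrime] {I J : Ideal A}
    (h : I.map (algebraMap A (Localization.AtPrime q)) ≤
      J.map (algebraMap A (Localization.AtPrime q))) :
    ¬ J.colon (I : Set A) ≤ q := by
  classical
  have key (s : A) (hs : s ∈ I) : ∃ t ∉ q, t * s ∈ J := by
    obtain ⟨⟨y, v⟩, hv⟩ := (IsLocalization.mem_map_algebraMap_iff q.primeCompl _).mp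
      (h (Ideal.mem_map_of_mem _ hs))
    rw [← map_mul] at hv
    obtain ⟨t, ht⟩ := (IsLocalization.eq_iff_exists q.primeCompl _).mp hv
    refine ⟨t * v, (t * v).2, ?_⟩
    rw [mul_assoc, mul_comm (v : A) s, ht]
    exact J.mul_mem_left _ y.2
  obtain ⟨S, rfl⟩ := (IsNoetherian.noetherian I)
  choose! t ht htJ using key
  intro hle
  have : ∏ s ∈ S, t s ∈ q := by
    apply hle
    rw [Submodule.mem_colon]
    intro x hx
    rw [SetLike.mem_coe] at hx
    induction hx using Submodule.span_induction with
    | mem x hx =>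
      rw [smul_eq_mul, ← Finset.prod_erase_mul _ _ hx, mul_assoc]
      exact J.mul_mem_left _ (htJ _ (Submodule.subset_span hx))
    | zero => simp
    | add x y _ _ hx hy => rw [smul_add]; exact J.add_mem hx hy
    | smul a x _ hx => rw [smul_comm]; exact J.mul_mem_left _ hx
  obtain ⟨s, hs, hsq⟩ := (Ideal.IsPrime.prod_mem_iff).mp this
  exact ht _ (Submodule.subset_span hs) hsq

lemma Ideal.exists_countable_not_colon_le_of_antitone {A : Type*} [CommRing A]
    [IsNoetherianRing A] {ι : Type*} (f : Set ι → Ideal A) (hf : Antitone f) (q : Ideal A)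
    [q.IsPrime] :
    ∃ C : Set ι, C.Countable ∧
      ∀ D : Set ι, D.Countable → C ⊆ D → ¬ (f D).colon (f C : Set A) ≤ q := by
  have : IsNoetherianRing (Localization.AtPrime q) :=
    IsLocalization.isNoetherianRing q.primeCompl _ inferInstance
  obtain ⟨C, hC, h⟩ := IsLocalRing.exists_countable_le_of_antitone
    (fun C => (f C).map (algebraMap A (Localization.AtPrime q)))
    (fun C D hCD => Ideal.map_mono (hf hCD))
  exact ⟨C, hC, fun D hD hCD => not_colon_le_of_map_localization_le q (h D hD hCD)⟩

lemma Ideal.exists_countable_height_of_antitone {A : Type*} [CommRing A]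
    [IsNoetherianRing A] {ι : Type*} (f : Set ι → Ideal A) (hf : Antitone f) (n : ℕ) :
    ∃ C : Set ι, C.Countable ∧ ∀ D : Set ι, D.Countable → C ⊆ D →
      ∀ q : Ideal A, q.IsPrime → (f D).colon (f C : Set A) ≤ q → n ≤ q.height := by
  induction n with
  | zero => exact ⟨∅, Set.countable_empty, by simp⟩
  | succ n ih =>
    obtain ⟨C, hC, h⟩ := ih
    let H : Set (Ideal A) := {q | q.IsPrime ∧ q.height = n ∧
      ∃ D : Set ι, D.Countable ∧ C ⊆ D ∧ (f D).colon (f C : Set A) ≤ q}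
    have hH : H.Finite := by
      by_contra hinf
      let g := Set.Infinite.natEmbedding H hinf
      choose D hD hCD hDq using fun k => (g k).2.2.2
      have hE : (⋃ k, D k).Countable := Set.countable_iUnion hD
      have hCE : C ⊆ ⋃ k, D k := (hCD 0).trans (Set.subset_iUnion D 0)
      have hle : (n : ℕ∞) ≤ ((f (⋃ k, D k)).colon (f C : Set A)).height := by
        rw [Ideal.height_eq_inf_minimalPrimes]
        exact le_iInf₂ fun q hq => h _ hE hCE q hq.1.1 hq.1.2
      refine (Set.infinite_range_of_injective
        (Subtype.val_injective.comp g.injective)).mono ?_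
        (((f (⋃ k, D k)).colon (f C : Set A)).finite_minimalPrimes_of_isNoetherianRing A)
      rintro _ ⟨k, rfl⟩
      have := (g k).2.1
      refine Ideal.mem_minimalPrimes_of_height_le (J := (g k : Ideal A)) ?_
        ((g k).2.2.1.le.trans hle)
      exact (Submodule.colon_mono (hf (Set.subset_iUnion D k)) le_rfl).trans (hDq k)
    choose! E hE hEq using fun (q : Ideal A) (hq : q.IsPrime) =>
      Ideal.exists_countable_not_colon_le_of_antitone f hf q
    refine ⟨C ∪ ⋃ q ∈ H, E q, hC.union (hH.countable.biUnion fun q hq => hE q hq.1), ?_⟩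
    intro D hD hsub q hq hDq
    have hCD := Set.subset_union_left.trans hsub
    have hcol {C' : Set ι} (h' : C' ⊆ C ∪ ⋃ q ∈ H, E q) : (f D).colon (f C' : Set A) ≤ q :=
      (Submodule.colon_mono le_rfl (hf h')).trans hDq
    have h1 := h D hD hCD q hq (hcol Set.subset_union_left)
    rw [Nat.cast_succ]
    refine Order.add_one_le_of_lt (lt_of_le_of_ne h1 fun heq => ?_)
    have hqH : q ∈ H := ⟨hq, heq.symm, D, hD, hCD, hcol Set.subset_union_left⟩
    have hEsub : E q ⊆ C ∪ ⋃ q ∈ H, E q :=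
      (Set.subset_biUnion_of_mem (u := E) hqH).trans Set.subset_union_right
    exact hEq q hq D hD (hEsub.trans hsub) (hcol hEsub)

/-- In a noetherian ring, an antitone family of ideals indexed by sets is stationary on countable
sets. -/
theorem Ideal.exists_countable_le_of_antitone {A : Type*} [CommRing A]
    [IsNoetherianRing A] {ι : Type*} (f : Set ι → Ideal A) (hf : Antitone f) :
    ∃ C : Set ι, C.Countable ∧ ∀ D : Set ι, D.Countable → C ⊆ D → f C ≤ f D := by
  choose C hC h using Ideal.exists_countable_height_of_antitone f hf
  refine ⟨⋃ n, C n, Set.countable_iUnion hC, fun D hD hsub => ?_⟩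
  by_contra hle
  obtain ⟨q, hq, hDq⟩ := Ideal.exists_le_maximal _
    (fun htop => hle ((Submodule.colon_eq_top_iff_subset _).mp htop))
  have := hq.isPrime
  refine Ideal.height_ne_top_of_isPrime (I := q) (ENat.eq_top_iff_forall_ge.mpr fun n => ?_)
  exact h n D hD ((Set.subset_iUnion C n).trans hsub) q hq.isPrime
    ((Submodule.colon_mono le_rfl (hf (Set.subset_iUnion C n))).trans hDq)

/-- In a noetherian ring, every intersection of ideals is the intersection of a countable
subfamily. -/
theorem Ideal.exists_countable_biInf_le {A : Type*} [CommRing A]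
    [IsNoetherianRing A] {ι : Type*} (a : ι → Ideal A) :
    ∃ C : Set ι, C.Countable ∧ ∀ i, ⨅ j ∈ C, a j ≤ a i := by
  obtain ⟨C, hC, h⟩ := Ideal.exists_countable_le_of_antitone (fun C => ⨅ j ∈ C, a j)
    (fun C D hCD => biInf_mono hCD)
  exact ⟨C, hC, fun i => (h (insert i C) (hC.insert i) (Set.subset_insert i C)).trans
    (iInf₂_le i (Set.mem_insert i C))⟩

lemma Set.exists_injective_forall_mem_of_infinite {α κ : Type*} [Countable κ] (S : κ → Set α)
    (hS : ∀ k, (S k).Infinite) :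
    ∃ g : κ → α, Function.Injective g ∧ ∀ k, g k ∈ S k := by
  classical
  obtain ⟨e, he⟩ := exists_injective_nat κ
  choose t ht htcard using fun k => (hS k).exists_subset_card_eq (e k + 1)
  obtain ⟨g, hg, hgt⟩ := (Finset.all_card_le_biUnion_card_iff_exists_injective t).mp fun s => by
    rcases s.eq_empty_or_nonempty with rfl | hs
    · simp
    obtain ⟨k, hk, hmax⟩ := s.exists_max_image e hs
    calc s.card = (s.image e).card := (Finset.card_image_of_injective s he).symm
      _ ≤ (Finset.range (e k + 1)).card := Finset.card_le_card fun m hm => by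
          obtain ⟨l, hl, rfl⟩ := Finset.mem_image.mp hm
          exact Finset.mem_range_succ_iff.mpr (hmax l hl)
      _ = (t k).card := by rw [htcard, Finset.card_range]
      _ ≤ _ := Finset.card_le_card (Finset.subset_biUnion_of_mem t hk)
  exact ⟨g, hg, fun k => ht k (hgt k)⟩

section AlmostAnnihilator

variable {A : Type*} [CommRing A] {I : Type*} {M : I → Type*} [∀ i, AddCommGroup (M i)]
  [∀ i, Module A (M i)]

/-- The ideal of elements annihilating all but finitely many of the `x i` with `i ∈ S`. -/
def almostAnnihilator (A : Type*) [CommRing A] {I : Type*} {M : I → Type*}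
    [∀ i, AddCommGroup (M i)] [∀ i, Module A (M i)] (S : Set I) (x : ∀ i, M i) : Ideal A where
  carrier := {r | {i ∈ S | r • x i ≠ 0}.Finite}
  zero_mem' := by simp
  add_mem' {a b} ha hb := (Set.Finite.union ha hb).subset fun i hi => by
    by_contra h
    simp only [Set.mem_union, Set.mem_ofPred_eq, not_or, not_and, not_not] at h
    exact hi.2 (by rw [add_smul, h.1 hi.1, h.2 hi.1, add_zero])
  smul_mem' a b hb := Set.Finite.subset hb fun i hi =>
    ⟨hi.1, fun h => hi.2 (by rw [smul_eq_mul, mul_smul, h, smul_zero])⟩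

lemma mem_almostAnnihilator {S : Set I} {x : ∀ i, M i} {r : A} :
    r ∈ almostAnnihilator A S x ↔ {i ∈ S | r • x i ≠ 0}.Finite := Iff.rfl

lemma almostAnnihilator_anti {S T : Set I} (h : S ⊆ T) (x : ∀ i, M i) :
    almostAnnihilator A T x ≤ almostAnnihilator A S x :=
  fun _ hr => Set.Finite.subset hr fun _ hi => ⟨h hi.1, hi.2⟩

lemma exists_infinite_subset_forall_mem_almostAnnihilator_or [IsNoetherianRing A] {S : Set I}
    (hS : S.Infinite) (x : ∀ i, M i) :
    ∃ T ⊆ S, T.Infinite ∧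
      ∀ r : A, r ∈ almostAnnihilator A T x ∨ {i ∈ T | r • x i = 0}.Finite := by
  obtain ⟨_, ⟨T, ⟨hTS, hT⟩, rfl⟩, hmax⟩ := (wellFounded_gt (α := Ideal A)).has_min
    ((fun T => almostAnnihilator A T x) '' {T | T ⊆ S ∧ T.Infinite}) ⟨_, S, ⟨le_rfl, hS⟩, rfl⟩
  refine ⟨T, hTS, hT, fun r => or_iff_not_imp_right.mpr fun hr => ?_⟩
  have hsub : {i ∈ T | r • x i = 0} ⊆ T := Set.sep_subset _ _
  have heq := eq_of_le_of_not_lt (almostAnnihilator_anti (A := A) hsub x)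
    (hmax _ ⟨_, ⟨hsub.trans hTS, hr⟩, rfl⟩)
  rw [heq, mem_almostAnnihilator]
  convert Set.finite_empty
  ext i
  simp +contextual

/-- If every nonzero element of a noetherian ring acts nontrivially on infinitely many members of a
family of modules, then this is witnessed by countably many elements of the product. -/
lemma exists_seq_forall_exists_finite [IsNoetherianRing A] [Nontrivial A]
    (h : ∀ r : A, r ≠ 0 → {i | ∃ y : M i, r • y ≠ 0}.Infinite) :
    ∃ (S : ℕ → Set I) (x : ℕ → ∀ i, M i), (∀ k, (S k).Infinite) ∧
      ∀ r : A, r ≠ 0 → ∃ k, {i ∈ S k | r • x k i = 0}.Finite := by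
  let ι := {p : Set I × (∀ i, M i) // p.1.Infinite ∧
    ∀ r : A, r ∈ almostAnnihilator A p.1 p.2 ∨ {i ∈ p.1 | r • p.2 i = 0}.Finite}
  have hι (r : A) (hr : r ≠ 0) : ∃ p : ι, r ∉ almostAnnihilator A p.1.1 p.1.2 := by
    choose! x hx using fun (i : I) (hi : ∃ y : M i, r • y ≠ 0) => hi
    obtain ⟨T, hTS, hT, hTr⟩ := exists_infinite_subset_forall_mem_almostAnnihilator_or
      (A := A) (h r hr) x
    refine ⟨⟨(T, x), hT, hTr⟩, fun hmem => hT (Set.Finite.subset hmem fun i hi => ⟨hi, ?_⟩)⟩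
    exact hx i (hTS hi)
  obtain ⟨C, hC, hle⟩ := Ideal.exists_countable_biInf_le
    (fun p : ι => almostAnnihilator A p.1.1 p.1.2)
  obtain ⟨p₀, -⟩ := hι 1 one_ne_zero
  obtain ⟨e, he⟩ := (hC.insert p₀).exists_eq_range (Set.insert_nonempty _ _)
  refine ⟨fun k => (e k).1.1, fun k => (e k).1.2, fun k => (e k).2.1, fun r hr => ?_⟩
  obtain ⟨p, hp⟩ := hι r hr
  have hnot : ∃ q ∈ C, r ∉ almostAnnihilator A q.1.1 q.1.2 := by
    by_contra! hcon
    exact hp (hle p (by simpa [Submodule.mem_iInf] using hcon))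
  obtain ⟨q, hq, hrq⟩ := hnot
  obtain ⟨k, rfl⟩ : q ∈ Set.range e := he ▸ Set.mem_insert_of_mem _ hq
  exact ⟨k, ((e k).2.2 r).resolve_left hrq⟩

end AlmostAnnihilator

lemma Subring.exists_noetherian_cover {R : Type*} [CommRing R] (D : Subring R)
    [IsNoetherianRing D] (x : ℕ → R) (hgen : Subring.closure (↑D ∪ Set.range x) = ⊤) :
    ∃ B : ℕ → Subring R, (∀ n, IsNoetherianRing (B n)) ∧ ∀ r, ∃ n, r ∈ B n := by
  let B (n : ℕ) : Subalgebra D R := Algebra.adjoin D (x '' Set.Iio n)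
  have hmono : Monotone B := fun m n h =>
    Algebra.adjoin_mono (Set.image_mono (Set.Iio_subset_Iio h))
  refine ⟨fun n => (B n).toSubring, fun n =>
    isNoetherianRing_of_fg (Subalgebra.fg_def.mpr ⟨_, (Set.finite_Iio n).image x, rfl⟩),
    fun r => ?_⟩
  have hr : r ∈ Subring.closure (↑D ∪ Set.range x) := hgen ▸ Subring.mem_top r
  induction hr using Subring.closure_induction with
  | mem y hy =>
    rcases hy with hy | ⟨n, rfl⟩
    · exact ⟨0, (B 0).algebraMap_mem ⟨y, hy⟩⟩
    · exact ⟨n + 1, Algebra.subset_adjoin ⟨n, Nat.lt_succ_self n, rfl⟩⟩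
  | zero => exact ⟨0, zero_mem _⟩
  | one => exact ⟨0, one_mem _⟩
  | neg y _ h => exact h.imp fun n hn => neg_mem hn
  | add y z _ _ hy hz =>
    obtain ⟨m, hm⟩ := hy
    obtain ⟨n, hn⟩ := hz
    exact ⟨max m n, add_mem (hmono (le_max_left m n) hm) (hmono (le_max_right m n) hn)⟩
  | mul y z _ _ hy hz =>
    obtain ⟨m, hm⟩ := hy
    obtain ⟨n, hn⟩ := hz
    exact ⟨max m n, mul_mem (hmono (le_max_left m n) hm) (hmono (le_max_right m n) hn)⟩

/-- Every commutative integral domain which is countably generated as a ring over a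
noetherian subring is productively bounded. -/
theorem productivelyBounded_of_noetherian_subring
    (R : Type u) [CommRing R] [IsDomain R] (D : Subring R) [IsNoetherianRing ↥D]
    (x : ℕ → R) (hgen : Subring.closure (↑D ∪ Set.range x) = ⊤) :
    ProductivelyBounded.{u, v, w} R := by
  classical
  intro I M _ _ htors
  by_contra! hcon
  obtain ⟨B, hB, hcover⟩ := D.exists_noetherian_cover x hgen
  have hinf (r : R) (hr : r ≠ 0) : {i | ∃ y : M i, r • y ≠ 0}.Infinite := fun hfin => by
    have hmem : r ∈ ⨅ i ∈ {i | ∃ y : M i, r • y ≠ 0}ᶜ, Module.annihilator R (M i) := by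
      simp [Submodule.mem_iInf, Module.mem_annihilator]
    rw [hcon _ (by rwa [compl_compl])] at hmem
    exact hr hmem
  choose S z hS hz using fun n => exists_seq_forall_exists_finite (A := B n) (M := M)
    fun r hr => hinf r (by simpa using hr)
  obtain ⟨g, hg, hgS⟩ := Set.exists_injective_forall_mem_of_infinite
    (fun p : ℕ × ℕ × ℕ => S p.1 p.2.1) (fun p => hS _ _)
  let y : ∀ i, M i := fun i => if h : ∃ p, g p = i then z h.choose.1 h.choose.2.1 i else 0
  have hy (p : ℕ × ℕ × ℕ) : y (g p) = z p.1 p.2.1 (g p) := by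
    have h : ∃ q, g q = g p := ⟨p, rfl⟩
    simp only [y, dif_pos h, hg h.choose_spec]
  obtain ⟨⟨a, ha⟩, hay⟩ := htors (x := y)
  obtain ⟨n, hn⟩ := hcover a
  obtain ⟨k, hk⟩ := hz n ⟨a, hn⟩ (by simpa using nonZeroDivisors.ne_zero ha)
  refine Set.infinite_range_of_injective (f := fun j : ℕ => g (n, k, j))
    (fun i j hij => by simpa using hg hij) (hk.subset ?_)
  rintro _ ⟨j, rfl⟩
  refine ⟨hgS (n, k, j), ?_⟩
  change a • z n k (g (n, k, j)) = 0
  rw [← hy (n, k, j)]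
  exact congrFun hay (g (n, k, j))
end

section
/- Suppose D is a subring of the commutative integral domain R such that R is countably generated over D as a ring. If the dual ideal lattice L_D of D is uniformly transversally bounded, then the dual ideal lattice L_R of R is uniformly transversally bounded. -/
universe u v w

/-- Uniform transversal boundedness, contraposed and in terms of elements. -/
theorem IdealUTB.exists_transversal {D : Type u} [CommRing D] [IsDomain D]
    (hD : IdealUTB.{u, v} D) {I : Type v} (X : I → Set (Ideal D)) (hX : ∀ i, (X i).Nonempty)
    (h : ∀ F : Set I, F.Finite → ∀ r, (∀ i ∉ F, ∀ A ∈ X i, r ∈ A) → r = 0) :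
    ∃ A : I → Ideal D, (∀ i, A i ∈ X i) ∧ ∀ r, (∀ i, r ∈ A i) → r = 0 := by
  by_contra! hA
  obtain ⟨J, hJ, hne⟩ := hD I X hX fun A hAX hbot => by
    obtain ⟨r, hr, hr0⟩ := hA A hAX
    exact hr0 (by simpa [hbot] using (Submodule.mem_iInf A).2 hr)
  obtain ⟨r, hr, hr0⟩ := Submodule.exists_mem_ne_zero_of_ne_bot hne
  refine hr0 (h Jᶜ hJ r fun i hi A hAi => ?_)
  exact Submodule.mem_sInf.1 hr A (Set.mem_biUnion (by simpa using hi) hAi)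

/-- The ideals indexed by `S` have a common nonzero element. -/
def HasCommonNonzero {D : Type u} [CommRing D] {I : Type w} (A : I → Ideal D) (S : Set I) : Prop :=
  ∃ a, a ≠ 0 ∧ ∀ i ∈ S, a ∈ A i

namespace HasCommonNonzero

variable {D : Type u} [CommRing D] {I : Type w} {A : I → Ideal D}

theorem mono {S T : Set I} (h : HasCommonNonzero A T) (hST : S ⊆ T) : HasCommonNonzero A S := by
  obtain ⟨a, ha, hm⟩ := h
  exact ⟨a, ha, fun i hi => hm i (hST hi)⟩

variable [IsDomain D]

theorem union {S T : Set I} (hS : HasCommonNonzero A S) (hT : HasCommonNonzero A T) :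
    HasCommonNonzero A (S ∪ T) := by
  obtain ⟨a, ha, hm⟩ := hS
  obtain ⟨b, hb, hn⟩ := hT
  refine ⟨a * b, mul_ne_zero ha hb, ?_⟩
  rintro i (hi | hi)
  · exact (A i).mul_mem_right _ (hm i hi)
  · exact (A i).mul_mem_left _ (hn i hi)

theorem biUnion {K : Type*} {F : Set K} (hF : F.Finite) {S : K → Set I}
    (h : ∀ k, HasCommonNonzero A (S k)) : HasCommonNonzero A (⋃ k ∈ F, S k) := by
  induction F, hF using Set.Finite.induction_on with
  | empty => exact ⟨1, one_ne_zero, by simp⟩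
  | insert _ _ ih =>
    rw [Set.biUnion_insert]
    exact (h _).union ih

theorem of_finite (hA : ∀ i, A i ≠ ⊥) {S : Set I} (hS : S.Finite) : HasCommonNonzero A S := by
  rw [← Set.biUnion_of_singleton S]
  refine biUnion hS fun i => ?_
  obtain ⟨a, ha, ha0⟩ := Submodule.exists_mem_ne_zero_of_ne_bot (hA i)
  exact ⟨a, ha0, by simpa using ha⟩

end HasCommonNonzero

/-- The ideal of elements lying in `A i` for all but finitely many `i ∈ S`. -/
def eventualIdeal {D : Type u} [CommRing D] {I : Type w} (A : I → Ideal D) (S : Set I) :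
    Ideal D where
  carrier := {a | {i ∈ S | a ∉ A i}.Finite}
  zero_mem' := by simp
  add_mem' {a b} ha hb := by
    refine (Set.Finite.union ha hb).subset fun i ⟨hi, hab⟩ => ?_
    by_cases h : a ∈ A i
    · exact Or.inr ⟨hi, fun h' => hab (add_mem h h')⟩
    · exact Or.inl ⟨hi, h⟩
  smul_mem' c a ha :=
    Set.Finite.subset ha fun i ⟨hi, h⟩ => ⟨hi, fun h' => h ((A i).mul_mem_left c h')⟩

theorem mem_eventualIdeal {D : Type u} [CommRing D] {I : Type w} {A : I → Ideal D} {S : Set I}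
    {a : D} : a ∈ eventualIdeal A S ↔ {i ∈ S | a ∉ A i}.Finite := Iff.rfl

theorem Set.Infinite.exists_infinite_diff {I : Type w} {W : Set I} (hW : W.Infinite) :
    ∃ S ⊆ W, S.Infinite ∧ (W \ S).Infinite := by
  have := hW.to_subtype
  let f : ℕ ↪ W := _root_.Infinite.natEmbedding W
  have hf : Function.Injective fun n => (f n : I) := Subtype.val_injective.comp f.injective
  refine ⟨Set.range fun n => (f (2 * n) : I), ?_, ?_, ?_⟩
  · rintro _ ⟨n, rfl⟩
    exact (f _).2
  · exact Set.infinite_range_of_injective fun a b h => by have := hf h; omega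
  · refine (Set.infinite_range_of_injective (f := fun n => (f (2 * n + 1) : I))
      fun a b h => by have := hf h; omega).mono ?_
    rintro _ ⟨n, rfl⟩
    refine ⟨(f _).2, ?_⟩
    rintro ⟨m, hm⟩
    have := hf hm
    omega

/-- In a uniformly transversally bounded domain, a family of nonzero ideals with zero
intersection splits into two subfamilies with zero intersection. -/
theorem IdealUTB.exists_split {D : Type u} [CommRing D] [IsDomain D]
    (hD : IdealUTB.{u, v} D) {I : Type w} (A : I → Ideal D) (hA : ∀ i, A i ≠ ⊥)
    (h : ¬ HasCommonNonzero A Set.univ) :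
    ∃ S : Set I, ¬ HasCommonNonzero A S ∧ ¬ HasCommonNonzero A Sᶜ := by
  by_contra! H
  have H' (S : Set I) : HasCommonNonzero A S ∨ HasCommonNonzero A Sᶜ := by
    by_cases hS : HasCommonNonzero A S
    · exact Or.inl hS
    · exact Or.inr (H S hS)
  have key : ∀ r, (∀ S, HasCommonNonzero A S → r ∈ eventualIdeal A S) → r = 0 := by
    intro r hr
    by_contra hr0
    have hW : {i | r ∉ A i}.Infinite := by
      intro hfin
      refine h (((HasCommonNonzero.of_finite hA hfin).union
        (T := {i | r ∈ A i}) ⟨r, hr0, fun i hi => hi⟩).mono fun i _ => ?_)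
      by_cases hi : r ∈ A i
      · exact Or.inr hi
      · exact Or.inl hi
    obtain ⟨S, hSW, hS, hWS⟩ := hW.exists_infinite_diff
    rcases H' S with hc | hc
    · exact hS ((mem_eventualIdeal.1 (hr S hc)).subset fun i hi => ⟨hi, hSW hi⟩)
    · exact hWS ((mem_eventualIdeal.1 (hr _ hc)).subset fun i hi => ⟨hi.2, hi.1⟩)
  -- Countably many of the ideals `eventualIdeal A S` already have zero intersection.
  obtain ⟨E, hE, hE0⟩ := hD.exists_transversal (I := ULift.{v} ℕ)
    (fun _ => {B | ∃ S, HasCommonNonzero A S ∧ B = eventualIdeal A S})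
    (fun _ => ⟨_, ∅, ⟨1, one_ne_zero, by simp⟩, rfl⟩) fun F hF r hr => by
      obtain ⟨k, hk⟩ := hF.infinite_compl.nonempty
      exact key r fun S hS => hr k hk _ ⟨S, hS, rfl⟩
  choose S hS hES using hE
  have notMem : ∀ a, a ≠ 0 → ∃ k, ¬ {i ∈ S k | a ∉ A i}.Finite := by
    intro a ha
    by_contra! hc
    exact ha (hE0 a fun k => by rw [hES k]; exact hc k)
  have hunion : ¬ HasCommonNonzero A (⋃ k, S k) := by
    rintro ⟨a, ha, hm⟩
    obtain ⟨k, hk⟩ := notMem a ha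
    refine hk (Set.finite_empty.subset ?_)
    rintro i ⟨hi, hai⟩
    exact hai (hm i (Set.mem_iUnion_of_mem k hi))
  -- The first differences of the sets `S k` admit a transversal with zero intersection.
  let B : ULift.{v} ℕ → Set I := fun k => {i ∈ S k | ∀ j : ULift.{v} ℕ, j.down < k.down → i ∉ S j}
  obtain ⟨C, hC, hC0⟩ := hD.exists_transversal (I := ULift.{v} ℕ)
    (fun k => insert ⊤ (A '' B k)) (fun k => ⟨⊤, by simp⟩) fun F hF r hr => by
      by_contra hr0
      refine hunion (((HasCommonNonzero.biUnion hF hS).union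
        (T := ⋃ k ∈ Fᶜ, B k) ⟨r, hr0, ?_⟩).mono ?_)
      · intro i hi
        simp only [Set.mem_iUnion] at hi
        obtain ⟨k, hk, hi⟩ := hi
        exact hr k hk _ (Or.inr ⟨i, hi, rfl⟩)
      · intro i hi
        have hex : ∃ n, i ∈ S ⟨n⟩ := by
          obtain ⟨k, hk⟩ := Set.mem_iUnion.1 hi
          exact ⟨k.down, hk⟩
        classical
        have hmin : i ∈ B ⟨Nat.find hex⟩ :=
          ⟨Nat.find_spec hex, fun j hj => Nat.find_min hex hj⟩
        by_cases hF' : (⟨Nat.find hex⟩ : ULift.{v} ℕ) ∈ F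
        · exact Or.inl (Set.mem_biUnion hF' hmin.1)
        · exact Or.inr (Set.mem_biUnion hF' hmin)
  have ht : ∀ k, ∃ t : Set I, t.Finite ∧ t ⊆ B k ∧ ∀ r, (∀ i ∈ t, r ∈ A i) → r ∈ C k := by
    intro k
    rcases hC k with hk | ⟨i, hi, hk⟩
    · exact ⟨∅, Set.finite_empty, Set.empty_subset _, by simp [hk]⟩
    · exact ⟨{i}, Set.finite_singleton i, by simpa using hi, by simp [← hk]⟩
  choose t htf htB htC using ht
  rcases H' (⋃ k, t k) with ⟨a, ha, hm⟩ | ⟨a, ha, hm⟩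
  · exact ha (hC0 a fun k => htC k a fun i hi => hm i (Set.mem_iUnion_of_mem k hi))
  · obtain ⟨k, hk⟩ := notMem a ha
    have hfin : {j : ULift.{v} ℕ | j.down ≤ k.down}.Finite :=
      (Set.finite_Iic k.down).preimage ULift.down_injective.injOn
    refine hk ((hfin.biUnion fun j _ => htf j).subset ?_)
    rintro i ⟨hi, hai⟩
    have hit : i ∈ ⋃ k, t k := by
      by_contra hc
      exact hai (hm i hc)
    obtain ⟨j, hj⟩ := Set.mem_iUnion.1 hit
    refine Set.mem_biUnion (x := j) ?_ hj
    by_contra! hlt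
    exact (htB j hj).2 k (by simpa using hlt) hi

/-- The ideals in the sets `X i`, for `i` in any cofinite part of `T`, have zero intersection. -/
def CofinitelyUnbounded {R : Type u} [CommRing R] {I : Type v} (X : I → Set (Ideal R))
    (T : Set I) : Prop :=
  ∀ F : Set I, F.Finite → ∀ r, (∀ i ∈ T, i ∉ F → ∀ A ∈ X i, r ∈ A) → r = 0

namespace CofinitelyUnbounded

variable {R : Type u} [CommRing R] {I : Type v} {X : I → Set (Ideal R)}

theorem mono {S T : Set I} (hS : CofinitelyUnbounded X S) (hST : S ⊆ T) :
    CofinitelyUnbounded X T :=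
  fun F hF r hr => hS F hF r fun i hi => hr i (hST hi)

theorem diff_finite {T F : Set I} (hT : CofinitelyUnbounded X T) (hF : F.Finite) :
    CofinitelyUnbounded X (T \ F) :=
  fun G hG r hr => hT (F ∪ G) (hF.union hG) r fun i hi hFG =>
    hr i ⟨hi, fun h => hFG (Or.inl h)⟩ fun h => hFG (Or.inr h)

theorem or_diff [IsDomain R] {T : Set I} (hT : CofinitelyUnbounded X T) (S : Set I) :
    CofinitelyUnbounded X S ∨ CofinitelyUnbounded X (T \ S) := by
  by_contra! hc
  obtain ⟨h₁, h₂⟩ := hc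
  simp only [CofinitelyUnbounded, not_forall] at h₁ h₂
  obtain ⟨F, hF, r, hr, hr0⟩ := h₁
  obtain ⟨G, hG, s, hs, hs0⟩ := h₂
  refine mul_ne_zero hr0 hs0 (hT (F ∪ G) (hF.union hG) _ fun i hi hFG A hA => ?_)
  by_cases hiS : i ∈ S
  · exact A.mul_mem_right _ (hr i hiS (fun h => hFG (Or.inl h)) A hA)
  · exact A.mul_mem_left _ (hs i ⟨hi, hiS⟩ (fun h => hFG (Or.inr h)) A hA)

/-- A cofinitely unbounded family has a partial transversal whose intersection avoids a given
cyclic `D`-submodule and which leaves the remaining indices cofinitely unbounded. -/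
theorem exists_partial_transversal [IsDomain R] {D : Subring R} (hD : IdealUTB.{u, v} ↥D)
    (hX : ∀ i, (X i).Nonempty) {T : Set I} (hT : CofinitelyUnbounded X T) {m : R} (hm : m ≠ 0) :
    ∃ (S : Set I) (A : I → Ideal R), S ⊆ T ∧ (∀ i, A i ∈ X i) ∧
      (∀ d : D, (∀ i ∈ S, d • m ∈ A i) → d = 0) ∧ CofinitelyUnbounded X (T \ S) := by
  classical
  by_cases hz : ∃ i ∈ T, ∃ A ∈ X i, ∀ d : D, d • m ∈ A → d = 0
  · obtain ⟨i, hi, B, hB, hd⟩ := hz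
    choose A₀ hA₀ using hX
    refine ⟨{i}, Function.update A₀ i B, by simpa using hi, fun j => ?_, ?_,
      hT.diff_finite (Set.finite_singleton i)⟩
    · rcases eq_or_ne j i with rfl | hj
      · simpa using hB
      · simpa [hj] using hA₀ j
    · simpa using hd
  push Not at hz
  let φ : Ideal R → Ideal D := fun A =>
    (A.restrictScalars D).comap (LinearMap.toSpanSingleton D R m)
  have hφ (A : Ideal R) (d : D) : d ∈ φ A ↔ d • m ∈ A := by simp [φ]
  let ψ (i : I) (A : Ideal R) : Ideal D := if i ∈ T then φ A else ⊤
  obtain ⟨B, hB, hB0⟩ := hD.exists_transversal (fun i => ψ i '' X i)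
    (fun i => (hX i).image _) fun F hF d hd => by
      have := hT F hF (d • m) fun i hi hiF A hA => by
        have := hd i hiF _ ⟨A, hA, rfl⟩
        rwa [show ψ i A = φ A from if_pos hi, hφ] at this
      simpa [Subring.smul_def, hm] using this
  choose A hA hAB using hB
  obtain ⟨S, hS, hSc⟩ := hD.exists_split B
    (fun i => by
      rw [← hAB i]
      by_cases hi : i ∈ T
      · obtain ⟨d, hd, hd0⟩ := hz i hi (A i) (hA i)
        rw [show ψ i (A i) = φ (A i) from if_pos hi]
        exact fun hbot => hd0 (by simpa [hbot] using (hφ _ d).2 hd)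
      · rw [show ψ i (A i) = ⊤ from if_neg hi]
        exact top_ne_bot)
    fun ⟨a, ha, hm⟩ => ha (hB0 a fun i => hm i trivial)
  have avoid : ∀ S : Set I, ¬ HasCommonNonzero B S →
      ∀ d : D, (∀ i ∈ T ∩ S, d • m ∈ A i) → d = 0 := by
    intro S hS d hd
    by_contra hd0
    refine hS ⟨d, hd0, fun i hi => ?_⟩
    rw [← hAB i]
    by_cases hiT : i ∈ T
    · rw [show ψ i (A i) = φ (A i) from if_pos hiT, hφ]
      exact hd i ⟨hiT, hi⟩
    · simp [ψ, hiT]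
  rcases hT.or_diff (T ∩ S) with hc | hc
  · refine ⟨T ∩ Sᶜ, A, Set.inter_subset_left, hA, avoid _ hSc, hc.mono ?_⟩
    exact fun i hi => ⟨hi.1, fun h => h.2 hi.2⟩
  · exact ⟨T ∩ S, A, Set.inter_subset_left, hA, avoid _ hS, hc⟩

end CofinitelyUnbounded

theorem exists_seq_span_of_closure_eq_top {R : Type u} [CommRing R] (D : Subring R) (x : ℕ → R)
    (hgen : Subring.closure (↑D ∪ Set.range x) = ⊤) :
    ∃ m : ℕ → R, ∀ r, ∃ n, r ∈ Submodule.span D (m '' Set.Iio n) := by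
  have hcount : (Submonoid.closure (Set.range x) : Set R).Countable := by
    have := (Set.countable_range x).to_subtype
    have : Countable (FreeMonoid (Set.range x)) := inferInstanceAs (Countable (List (Set.range x)))
    rw [Submonoid.closure_eq_mrange, MonoidHom.coe_mrange]
    exact Set.countable_range _
  obtain ⟨m, hm⟩ := hcount.exists_eq_range ⟨1, one_mem _⟩
  refine ⟨m, fun r => ?_⟩
  have hadj : r ∈ Algebra.adjoin D (Set.range x) := by
    have hle : Subring.closure (↑D ∪ Set.range x) ≤ (Algebra.adjoin D (Set.range x)).toSubring := by
      rw [Subring.closure_le]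
      rintro y (hy | hy)
      · exact (Algebra.adjoin D (Set.range x)).algebraMap_mem ⟨y, hy⟩
      · exact Algebra.subset_adjoin hy
    exact hle (hgen ▸ Subring.mem_top r)
  have hspan : r ∈ Submodule.span D (Set.range m) := by
    rw [← hm, ← Algebra.adjoin_eq_span]
    exact hadj
  have hmono : Monotone fun n => Submodule.span D (m '' Set.Iio n) :=
    fun a b hab => Submodule.span_mono (Set.image_mono (Set.Iio_subset_Iio hab))
  have hle : Submodule.span D (Set.range m) ≤ ⨆ n, Submodule.span D (m '' Set.Iio n) := by
    rw [Submodule.span_le]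
    rintro _ ⟨n, rfl⟩
    exact Submodule.mem_iSup_of_mem (n + 1)
      (Submodule.subset_span ⟨n, Set.mem_Iio.2 n.lt_succ_self, rfl⟩)
  exact (Submodule.mem_iSup_of_directed _ hmono.directed_le).1 (hle hspan)

/-- Suppose `D` is a subring of the commutative integral domain `R` such that `R` is
countably generated over `D` as a ring.  If the dual ideal lattice `L_D` of `D` is
uniformly transversally bounded, then so is the dual ideal lattice `L_R` of `R`. -/
theorem idealUTB_of_countably_generated_extension
    (R : Type u) [CommRing R] [IsDomain R] (D : Subring R) (x : ℕ → R)
    (hgen : Subring.closure (↑D ∪ Set.range x) = ⊤)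
    (hD : IdealUTB.{u, v} ↥D) :
    IdealUTB.{u, v} R := by
  classical
  intro I X hX hA
  by_contra! hJ
  have hgood : CofinitelyUnbounded X Set.univ := by
    intro F hF r hr
    have hbot := hJ Fᶜ (by simpa using hF)
    rw [← Submodule.mem_bot R, ← hbot, Submodule.mem_sInf]
    intro A hA
    simp only [Set.mem_iUnion] at hA
    obtain ⟨i, hi, hA⟩ := hA
    exact hr i trivial hi A hA
  obtain ⟨m, hm⟩ := exists_seq_span_of_closure_eq_top D x hgen
  -- A state is a set of unused indices together with a transversal; on the used indices, the
  -- intersection of the transversal avoids the span of the first `n` elements of `m`.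
  let P (n : ℕ) (p : Set I × (I → Ideal R)) : Prop :=
    CofinitelyUnbounded X p.1 ∧ (∀ i, p.2 i ∈ X i) ∧
      ∀ r ∈ Submodule.span D (m '' Set.Iio n), (∀ i ∉ p.1, r ∈ p.2 i) → r = 0
  have step : ∀ n p, P n p → ∃ q, P (n + 1) q ∧ q.1 ⊆ p.1 ∧ ∀ i ∉ p.1, q.2 i = p.2 i := by
    rintro n ⟨T, A⟩ ⟨hT, hAX, hA0⟩
    by_cases hdone : ∀ r ∈ Submodule.span D (m '' Set.Iio (n + 1)), (∀ i ∉ T, r ∈ A i) → r = 0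
    · exact ⟨(T, A), ⟨hT, hAX, hdone⟩, subset_rfl, fun _ _ => rfl⟩
    push Not at hdone
    obtain ⟨e, he, heA, he0⟩ := hdone
    obtain ⟨S, A', hST, hA', hS, hTS⟩ := hT.exists_partial_transversal hD hX he0
    refine ⟨(T \ S, fun i => if i ∈ T then A' i else A i), ⟨hTS, fun i => ?_, ?_⟩,
      Set.sdiff_subset, fun i hi => if_neg hi⟩
    · dsimp only
      split_ifs
      exacts [hA' i, hAX i]
    intro e' he' heA'
    have hIio : m '' Set.Iio (n + 1) = insert (m n) (m '' Set.Iio n) := by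
      rw [← Set.image_insert_eq]
      congr 1
      ext k
      simp only [Set.mem_Iio, Set.mem_insert_iff]
      omega
    rw [hIio, Submodule.mem_span_insert] at he he'
    obtain ⟨d, f, hf, rfl⟩ := he
    obtain ⟨d', f', hf', rfl⟩ := he'
    have hd : d ≠ 0 := by
      rintro rfl
      simp only [zero_smul, zero_add] at heA he0
      exact he0 (hA0 f hf heA)
    have heq : d' • (d • m n + f) = d • (d' • m n + f') := by
      have hcomb : d' • (d • m n + f) - d • (d' • m n + f') = d' • f - d • f' := by
        rw [smul_add, smul_add, smul_comm d d' (m n)]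
        abel
      rw [← sub_eq_zero, hcomb]
      refine hA0 _ (sub_mem (Submodule.smul_mem _ _ hf) (Submodule.smul_mem _ _ hf'))
        fun i hi => ?_
      rw [← hcomb]
      have hmem := heA' i fun h => hi h.1
      simp only [if_neg (show i ∉ T from hi)] at hmem
      exact sub_mem ((A i).mul_mem_left _ (heA i hi)) ((A i).mul_mem_left _ hmem)
    have hd' : d' = 0 := hS d' fun i hi => by
      rw [heq]
      have hmem := heA' i fun h => h.2 hi
      simp only [if_pos (hST hi)] at hmem
      exact (A' i).mul_mem_left _ hmem
    rw [hd', zero_smul, ← hd'] at heq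
    exact (smul_eq_zero.1 heq.symm).resolve_left hd
  choose next hnext hsub hagree using step
  choose A₀ hA₀ using hX
  let s : ∀ n, {p // P n p} := fun n =>
    Nat.rec ⟨(Set.univ, A₀), hgood, hA₀, by simp⟩ (fun n p => ⟨next n p.1 p.2, hnext n p.1 p.2⟩) n
  have hs : ∀ n k, (s (n + k)).1.1 ⊆ (s n).1.1 ∧ ∀ i ∉ (s n).1.1, (s (n + k)).1.2 i = (s n).1.2 i := by
    intro n k
    induction k with
    | zero => exact ⟨subset_rfl, fun _ _ => rfl⟩
    | succ k ih =>
      exact ⟨(hsub _ _ (s (n + k)).2).trans ih.1, fun i hi =>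
        (hagree _ _ (s (n + k)).2 i fun h => hi (ih.1 h)).trans (ih.2 i hi)⟩
  let A (i : I) : Ideal R :=
    if h : ∃ n, i ∉ (s n).1.1 then (s (Nat.find h)).1.2 i else A₀ i
  have hAs : ∀ n, ∀ i ∉ (s n).1.1, A i = (s n).1.2 i := by
    intro n i hi
    have h : ∃ n, i ∉ (s n).1.1 := ⟨n, hi⟩
    obtain ⟨k, hk⟩ := Nat.exists_eq_add_of_le (Nat.find_min' h hi)
    rw [show A i = (s (Nat.find h)).1.2 i from dif_pos h, ← (hs (Nat.find h) k).2 i (Nat.find_spec h),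
      ← hk]
  refine hA A (fun i => ?_) ((Submodule.eq_bot_iff _).2 fun r hr => ?_)
  · by_cases h : ∃ n, i ∉ (s n).1.1
    · obtain ⟨n, hn⟩ := h
      rw [hAs n i hn]
      exact (s n).2.2.1 i
    · rw [show A i = A₀ i from dif_neg h]
      exact hA₀ i
  · obtain ⟨n, hn⟩ := hm r
    refine (s n).2.2.2 r hn fun i hi => ?_
    rw [← hAs n i hi]
    exact (Submodule.mem_iInf A).1 hr i
end

section
/- Suppose D is a subring of the commutative integral domain R such that R is countably generated over D as a ring, and suppose the lattice of ideals of D contains no subset order-isomorphic to the power set of omega (this holds whenever D has Krull dimension in the sense of Gordon and Robson). If D is weakly productively bounded, then the dual ideal lattice L_R of R is uniformly transversally bounded. -/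
universe u v w

section Independence

variable {D : Type*} [CommRing D] {I : Type*}

/-- A sequence of ideals, each of which fails to contain the intersection of the others, gives
an embedding of the power set of `ℕ` in the lattice of ideals. -/
theorem exists_powerset_embedding_of_mem_iff_ne {a : ℕ → Ideal D} {t : ℕ → D}
    (h : ∀ m n, t n ∈ a m ↔ m ≠ n) :
    ∃ f : Set ℕ → Ideal D, Function.Injective f ∧ ∀ A B : Set ℕ, A ⊆ B ↔ f A ≤ f B := by
  have key : ∀ A B : Set ℕ, A ⊆ B ↔ (⨅ n ∈ Aᶜ, a n) ≤ ⨅ n ∈ Bᶜ, a n := by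
    refine fun A B => ⟨fun hAB => biInf_mono fun n hn hA => hn (hAB hA), fun hle n hn => ?_⟩
    by_contra hB
    have ht : t n ∈ ⨅ m ∈ Aᶜ, a m := by
      simp only [Submodule.mem_iInf]
      exact fun m hm => (h m n).2 fun hmn => hm (hmn ▸ hn)
    have h' := hle ht
    simp only [Submodule.mem_iInf] at h'
    exact (h n n).1 (h' n hB) rfl
  exact ⟨fun A => ⨅ n ∈ Aᶜ, a n, fun A B hAB =>
    Set.Subset.antisymm ((key A B).2 hAB.le) ((key B A).2 hAB.ge), key⟩

theorem eventually_disjoint_of_pairwise_disjoint {G : ℕ → Finset I}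
    (hG : Pairwise fun m n => Disjoint (G m) (G n)) (F : Finset I) :
    ∀ᶠ n in Filter.atTop, Disjoint (G n) F := by
  classical
  induction F using Finset.induction_on with
  | empty => simp
  | insert i F _ ih =>
    have hi : ∀ᶠ n in Filter.atTop, i ∉ G n := by
      by_cases h : ∃ m, i ∈ G m
      · obtain ⟨m, hm⟩ := h
        filter_upwards [Filter.eventually_gt_atTop m] with n hn hin
        exact Finset.disjoint_left.1 (hG hn.ne) hm hin
      · exact Filter.Eventually.of_forall fun n hn => h ⟨n, hn⟩
    filter_upwards [ih, hi] with n h₁ h₂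
    exact Finset.disjoint_insert_right.2 ⟨h₂, h₁⟩

/-- The case in which the multiples of `d` by finite intersections are eventually absorbed. -/
theorem exists_ideal_of_absorbing {a : I → Ideal D} {S : Set I} (hS : S.Infinite) {d : D}
    (hd : ∀ i ∈ S, d * d ∉ a i)
    (hC : ∀ S' ⊆ S, S'.Infinite → ∃ G : Finset I, G.Nonempty ∧ ↑G ⊆ S' ∧ ∃ S'' ⊆ S',
      S''.Infinite ∧ ∀ w, (∀ i ∈ G, w ∈ a i) → {i ∈ S'' | d * w ∉ a i}.Finite) :
    ∃ Q : Ideal D, d ∉ Q ∧ ∃ G : ℕ → Finset I, (Pairwise fun m n => Disjoint (G m) (G n)) ∧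
      ∀ φ : ℕ → ℕ, φ.Injective → (⨅ n, ⨅ i ∈ G (φ n), a i) ≤ Q := by
  have step : ∀ s : {S' : Set I // S' ⊆ S ∧ S'.Infinite}, ∃ (G : Finset I)
      (s' : {S' : Set I // S' ⊆ S ∧ S'.Infinite}), G.Nonempty ∧ ↑G ⊆ s.1 ∧ s'.1 ⊆ s.1 ∧
      Disjoint s'.1 ↑G ∧ ∀ w, (∀ i ∈ G, w ∈ a i) → {i ∈ s'.1 | d * w ∉ a i}.Finite := by
    rintro ⟨S', hS', hinf⟩
    obtain ⟨G, hne, hG, S'', hsub, hinf'', hw⟩ := hC S' hS' hinf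
    exact ⟨G, ⟨S'' \ ↑G, Set.sdiff_subset.trans (hsub.trans hS'), hinf''.sdiff G.finite_toSet⟩,
      hne, hG, Set.sdiff_subset.trans hsub, Set.disjoint_sdiff_left,
      fun w h => (hw w h).subset fun i hi => ⟨hi.1.1, hi.2⟩⟩
  choose G nxt hne hG hnxt hdisj hfin using step
  let s : ℕ → {S' : Set I // S' ⊆ S ∧ S'.Infinite} := fun n => nxt^[n] ⟨S, subset_rfl, hS⟩
  have hs : ∀ n, s (n + 1) = nxt (s n) := fun n => Function.iterate_succ_apply' _ _ _
  have hanti : Antitone fun n => (s n).1 := antitone_nat_of_succ_le fun n => by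
    change (s (n + 1)).1 ⊆ (s n).1
    rw [hs]
    exact hnxt _
  have hlt : ∀ m n, m < n → Disjoint (G (s m)) (G (s n)) := fun m n hmn => by
    have h₁ : ((G (s n) : Finset I) : Set I) ⊆ (nxt (s m)).1 :=
      (hG _).trans (hs m ▸ hanti hmn)
    exact Finset.disjoint_coe.1 ((hdisj (s m)).symm.mono_right h₁)
  have hpair : Pairwise fun m n => Disjoint (G (s m)) (G (s n)) := fun m n hmn => by
    rcases hmn.lt_or_gt with h | h
    · exact hlt m n h
    · exact (hlt n m h).symm
  let Q : Ideal D :=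
    { carrier := {t | ∀ᶠ n in Filter.atTop, ∀ i ∈ G (s n), d * t ∈ a i}
      add_mem' := fun {x y} hx hy => by
        filter_upwards [hx, hy] with n h₁ h₂ i hi
        rw [mul_add]
        exact add_mem (h₁ i hi) (h₂ i hi)
      zero_mem' := Filter.Eventually.of_forall fun n i _ => by simp
      smul_mem' := fun c x hx => by
        filter_upwards [hx] with n h i hi
        rw [smul_eq_mul, mul_left_comm]
        exact Ideal.mul_mem_left _ _ (h i hi) }
  refine ⟨Q, fun hQ => ?_, fun n => G (s n), hpair, fun φ _ t ht => ?_⟩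
  · obtain ⟨n, hn⟩ := Filter.Eventually.exists (f := Filter.atTop) hQ
    obtain ⟨i, hi⟩ := hne (s n)
    exact hd i ((s n).2.1 (hG _ hi)) (hn i hi)
  · simp only [Submodule.mem_iInf] at ht
    have hF := hfin (s (φ 0)) t (ht 0)
    change ∀ᶠ n in Filter.atTop, ∀ i ∈ G (s n), d * t ∈ a i
    filter_upwards [eventually_disjoint_of_pairwise_disjoint hpair hF.toFinset,
      Filter.eventually_gt_atTop (φ 0)] with n h₁ h₂ i hi
    by_contra hni
    refine Finset.disjoint_left.1 h₁ hi (hF.mem_toFinset.2 ⟨?_, hni⟩)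
    rw [← hs]
    exact hanti (Nat.succ_le_of_lt h₂) (hG _ hi)

theorem exists_ideal_of_sq_notMem
    (hD : ¬ ∃ (b : ℕ → Ideal D) (t : ℕ → D), ∀ m n, t n ∈ b m ↔ m ≠ n)
    {a : I → Ideal D} {S : Set I} (hS : S.Infinite) {d : D} (hd : ∀ i ∈ S, d * d ∉ a i) :
    ∃ Q : Ideal D, d ∉ Q ∧ ∃ G : ℕ → Finset I, (Pairwise fun m n => Disjoint (G m) (G n)) ∧
      ∀ φ : ℕ → ℕ, φ.Injective → (⨅ n, ⨅ i ∈ G (φ n), a i) ≤ Q := by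
  classical
  by_contra hQ
  refine hQ (exists_ideal_of_absorbing hS hd ?_)
  by_contra! hC
  obtain ⟨S', hS', hinf, hC⟩ := hC
  have step : ∀ s : {p : Finset I × Set I // ↑p.1 ⊆ S' ∧ p.2 ⊆ S' ∧ p.2.Infinite},
      ∃ (j : I) (t : D) (K : Set I), j ∈ s.1.2 ∧ K ⊆ s.1.2 ∧ K.Infinite ∧ t ∉ a j ∧
        (∀ i ∈ K, t ∈ a i) ∧ ∀ i ∈ s.1.1, t ∈ a i := by
    rintro ⟨⟨F, S₁⟩, hF, hS₁, hinf₁⟩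
    dsimp only at hF hS₁ hinf₁ ⊢
    obtain ⟨w, hw, hwinf⟩ : ∃ w, (∀ i ∈ F, w ∈ a i) ∧ {i ∈ S₁ | d * w ∉ a i}.Infinite := by
      rcases F.eq_empty_or_nonempty with rfl | hne
      · refine ⟨1, by simp, hinf₁.mono fun i hi => ⟨hi, fun h => ?_⟩⟩
        rw [mul_one] at h
        exact hd i (hS' (hS₁ hi)) (Ideal.mul_mem_left _ _ h)
      · exact hC F hne hF S₁ hS₁ hinf₁
    set S₂ := {i ∈ S₁ | d * w ∉ a i} with hS₂
    let P : Ideal D := ⨆ K : {K : Set I // K ⊆ S₂ ∧ K.Infinite},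
      (⨅ i ∈ K.1, a i) ⊓ ⨅ i ∈ F, a i
    have hdP : d * w ∈ P := by
      by_contra hdP
      let e := hwinf.natEmbedding
      refine hQ ⟨Submodule.comap (LinearMap.mulRight D w) P, hdP, fun n => {(e n : I)}, ?_, ?_⟩
      · intro m n hmn
        simpa [Subtype.coe_inj] using hmn
      · intro φ hφ t ht
        have hinj : Function.Injective fun n => (e (φ n) : I) :=
          Subtype.val_injective.comp (e.injective.comp hφ)
        refine le_iSup (fun K : {K : Set I // K ⊆ S₂ ∧ K.Infinite} =>
          (⨅ i ∈ K.1, a i) ⊓ ⨅ i ∈ F, a i)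
          ⟨Set.range fun n => (e (φ n) : I), ?_, Set.infinite_range_of_injective hinj⟩ ?_
        · rintro _ ⟨n, rfl⟩
          exact (e (φ n)).2
        · simp only [Submodule.mem_iInf, Finset.mem_singleton, forall_eq] at ht
          simp only [LinearMap.mulRight_apply, Submodule.mem_inf, Submodule.mem_iInf,
            Set.forall_mem_range]
          exact ⟨fun n => Ideal.mul_mem_right _ _ (ht n),
            fun i hi => Ideal.mul_mem_left _ _ (hw i hi)⟩
    obtain ⟨j, hj⟩ := hwinf.nonempty
    obtain ⟨⟨K, hK, hKinf⟩, hKj⟩ : ∃ K : {K : Set I // K ⊆ S₂ ∧ K.Infinite},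
        ¬ (⨅ i ∈ K.1, a i) ⊓ (⨅ i ∈ F, a i) ≤ a j := by
      by_contra! h
      exact hj.2 (iSup_le h hdP)
    obtain ⟨t, ht, htj⟩ := SetLike.not_le_iff_exists.1 hKj
    simp only [Submodule.mem_inf, Submodule.mem_iInf] at ht
    exact ⟨j, t, K, hj.1, hK.trans (Set.sep_subset _ _), hKinf, htj, ht.1, ht.2⟩
  choose j t K hj hK hKinf htj htK htF using step
  let nxt : {p : Finset I × Set I // ↑p.1 ⊆ S' ∧ p.2 ⊆ S' ∧ p.2.Infinite} →
      {p : Finset I × Set I // ↑p.1 ⊆ S' ∧ p.2 ⊆ S' ∧ p.2.Infinite} := fun s =>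
    ⟨(insert (j s) s.1.1, K s), by
      rw [Finset.coe_insert]
      exact Set.insert_subset (s.2.2.1 (hj s)) s.2.1, (hK s).trans s.2.2.1, hKinf s⟩
  let s : ℕ → {p : Finset I × Set I // ↑p.1 ⊆ S' ∧ p.2 ⊆ S' ∧ p.2.Infinite} :=
    fun n => nxt^[n] ⟨(∅, S'), by simp, subset_rfl, hinf⟩
  have hs : ∀ n, s (n + 1) = nxt (s n) := fun n => Function.iterate_succ_apply' _ _ _
  have hanti : Antitone fun n => (s n).1.2 := antitone_nat_of_succ_le fun n => by
    change (s (n + 1)).1.2 ⊆ (s n).1.2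
    rw [hs]
    exact hK _
  have hmono : Monotone fun n => (s n).1.1 := monotone_nat_of_le_succ fun n => by
    rw [hs]
    exact Finset.subset_insert _ _
  refine hD ⟨fun n => a (j (s n)), fun n => t (s n), fun m n => ⟨?_, fun hmn => ?_⟩⟩
  · rintro h rfl
    exact htj _ h
  · rcases hmn.lt_or_gt with h | h
    · refine htF (s n) _ (hmono (Nat.succ_le_of_lt h) ?_)
      change j (s m) ∈ (s (m + 1)).1.1
      rw [hs]
      exact Finset.mem_insert_self _ _
    · refine htK (s n) _ ?_
      have : (s m).1.2 ⊆ (s (n + 1)).1.2 := hanti (Nat.succ_le_of_lt h)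
      rw [hs] at this
      exact this (hj _)

end Independence

section Selection

variable {D R : Type u} [CommRing D] [IsDomain D] [CommRing R] [Algebra D R]
  {I : Type v} {X : I → Set (Ideal R)}

/-- A transversal of `X` together with a sequence of pairwise disjoint finite sets of indices. -/
structure TransversalBlocks (X : I → Set (Ideal R)) where
  /-- the transversal -/
  ideal : I → Ideal R
  mem : ∀ i, ideal i ∈ X i
  /-- the sequence of finite index sets -/
  block : ℕ → Finset I
  disjoint : Pairwise fun m n => Disjoint (block m) (block n)

namespace TransversalBlocks

/-- The intersection of the ideals of the transversal over the blocks selected by `φ`. -/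
def inf (τ : TransversalBlocks X) (φ : ℕ → ℕ) : Ideal R :=
  ⨅ n, ⨅ i ∈ τ.block (φ n), τ.ideal i

/-- Pass to a subsequence of the blocks. -/
def thin (τ : TransversalBlocks X) (φ : ℕ → ℕ) (hφ : φ.Injective) : TransversalBlocks X where
  ideal := τ.ideal
  mem := τ.mem
  block := τ.block ∘ φ
  disjoint := fun _ _ h => τ.disjoint (hφ.ne h)

theorem inf_le_inf_comp (τ : TransversalBlocks X) (φ ψ : ℕ → ℕ) :
    τ.inf φ ≤ τ.inf (φ ∘ ψ) :=
  le_iInf fun n => iInf_le (fun n => ⨅ i ∈ τ.block (φ n), τ.ideal i) (ψ n)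

end TransversalBlocks

/-- The intersection, over a family of transversals with blocks, of the ideals in the blocks
selected by `σ`. -/
def selectionInf {ι : Type*} (τ : ι → TransversalBlocks X) (σ : ι → ℕ → ℕ) : Ideal R :=
  ⨅ s, (τ s).inf (σ s)

theorem exists_blocks_smul_mem_imp_eq_zero [Module.IsTorsionFree D R]
    (hD : ¬ ∃ (b : ℕ → Ideal D) (t : ℕ → D), ∀ m n, t n ∈ b m ↔ m ≠ n)
    (hwpb : WeaklyProductivelyBounded.{u, u, u} D) (hX : ∀ i, (X i).Nonempty)
    (hbot : ∀ J : Set I, Jᶜ.Finite → sInf (⋃ i ∈ J, X i) = ⊥) {w : R} (hw : w ≠ 0) :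
    ∃ (ι : Type u) (_ : Countable ι) (τ : ι → TransversalBlocks X),
      ∀ σ : ι → ℕ → ℕ, (∀ s, (σ s).Injective) →
        ∀ c : D, c • w ∈ selectionInf τ σ → c = 0 := by
  classical
  have key : ∀ d : {d : D // d ≠ 0}, ∃ (Q : Ideal D) (τ : TransversalBlocks X), d.1 ∉ Q ∧
      ∀ φ : ℕ → ℕ, φ.Injective → ∀ c : D, c • w ∈ τ.inf φ → c ∈ Q := by
    rintro ⟨d, hd⟩
    have hdw : (d * d) • w ≠ 0 := smul_ne_zero (mul_ne_zero hd hd) hw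
    have hS : {i | ∃ A ∈ X i, (d * d) • w ∉ A}.Infinite := by
      intro hfin
      refine hdw ((Submodule.mem_bot R).1 ?_)
      rw [← hbot {i | ∃ A ∈ X i, (d * d) • w ∉ A}ᶜ (by rwa [compl_compl])]
      simp only [Submodule.mem_sInf, Set.mem_iUnion]
      rintro A ⟨i, hi, hA⟩
      by_contra hnA
      exact hi ⟨A, hA, hnA⟩
    have hA : ∀ i, ∃ A ∈ X i,
        i ∈ {i | ∃ A ∈ X i, (d * d) • w ∉ A} → (d * d) • w ∉ A := by
      intro i
      by_cases hi : ∃ A ∈ X i, (d * d) • w ∉ A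
      · obtain ⟨A, hA, h⟩ := hi
        exact ⟨A, hA, fun _ => h⟩
      · obtain ⟨A, hA⟩ := hX i
        exact ⟨A, hA, fun h => absurd h hi⟩
    choose A hAX hAw using hA
    let a : I → Ideal D := fun i =>
      ((A i).restrictScalars D).comap (LinearMap.toSpanSingleton D R w)
    have ha : ∀ i c, c ∈ a i ↔ c • w ∈ A i := fun i c => Iff.rfl
    obtain ⟨Q, hdQ, G, hG, hQ⟩ := exists_ideal_of_sq_notMem hD (a := a) hS (d := d)
      fun i hi => hAw i hi
    refine ⟨Q, ⟨A, hAX, G, hG⟩, hdQ, fun φ hφ c hc => hQ φ hφ ?_⟩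
    simpa only [TransversalBlocks.inf, Submodule.mem_iInf, ha] using hc
  choose Q τ hQ hτ using key
  obtain ⟨m, hm⟩ : ∃ m : ULift.{u} ℕ → Π₀ d : {d : D // d ≠ 0}, D ⧸ Q d,
      ∀ c : D, c • m = 0 → c = 0 := by
    by_contra! h
    have htor : Module.IsTorsion D
        (∀ _ : ULift.{u} ℕ, Π₀ d : {d : D // d ≠ 0}, D ⧸ Q d) := by
      intro m
      obtain ⟨c, hc, hc0⟩ := h m
      exact ⟨⟨c, mem_nonZeroDivisors_of_ne_zero hc0⟩, hc⟩
    refine Set.infinite_univ ((hwpb _ _ htor).subset fun k _ => ?_)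
    refine (Submodule.eq_bot_iff _).2 fun c hc => ?_
    by_contra hc0
    have h1 := Module.mem_annihilator.1 hc (DFinsupp.single ⟨c, hc0⟩ (Ideal.Quotient.mk _ 1))
    have h2 := DFunLike.congr_fun h1 ⟨c, hc0⟩
    rw [DFinsupp.smul_apply, DFinsupp.single_eq_same, DFinsupp.zero_apply] at h2
    change Ideal.Quotient.mk _ (c • 1) = 0 at h2
    rw [smul_eq_mul, mul_one] at h2
    exact hQ ⟨c, hc0⟩ (Ideal.Quotient.eq_zero_iff_mem.1 h2)
  let ι := {p : ULift.{u} ℕ × {d : D // d ≠ 0} // m p.1 p.2 ≠ 0}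
  have hι : Countable ι := by
    have : Function.Injective fun p : ι =>
        (⟨p.1.1, p.1.2, DFinsupp.mem_support_iff.2 p.2⟩ : Σ k, (m k).support) := by
      rintro ⟨⟨k, d⟩, hp⟩ ⟨⟨k', d'⟩, hp'⟩ h
      simp only [Sigma.mk.injEq] at h
      obtain ⟨rfl, h⟩ := h
      simp only [heq_eq_eq, Subtype.mk.injEq] at h
      subst h
      rfl
    exact this.countable
  refine ⟨ι, hι, fun p => τ p.1.2, fun σ hσ c hc => hm c ?_⟩
  funext k
  ext d
  by_cases hkd : m k d = 0
  · simp [hkd]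
  · have hcQ := hτ d (σ ⟨(k, d), hkd⟩) (hσ _) c ((Submodule.mem_iInf _).1 hc ⟨(k, d), hkd⟩)
    obtain ⟨y, hy⟩ := Ideal.Quotient.mk_surjective (m k d)
    rw [Pi.smul_apply, DFinsupp.smul_apply, ← hy]
    change Ideal.Quotient.mk _ (c • y) = 0
    exact Ideal.Quotient.eq_zero_iff_mem.2 (Ideal.mul_mem_right _ _ hcQ)

theorem exists_blocks_disjoint_of_not_linearIndependent [Module.IsTorsionFree D R]
    (hD : ¬ ∃ (b : ℕ → Ideal D) (t : ℕ → D), ∀ m n, t n ∈ b m ↔ m ≠ n)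
    (hwpb : WeaklyProductivelyBounded.{u, u, u} D) (hX : ∀ i, (X i).Nonempty)
    (hbot : ∀ J : Set I, Jᶜ.Finite → sInf (⋃ i ∈ J, X i) = ⊥) (V : Submodule D R) (r : ℕ)
    {ι : Type u} [Countable ι] (τ : ι → TransversalBlocks X)
    (h : ∀ σ : ι → ℕ → ℕ, (∀ s, (σ s).Injective) → ∀ v : Fin r → R,
      (∀ j, v j ∈ selectionInf τ σ) → (∀ j, v j ∈ V) → ¬ LinearIndependent D v) :
    ∃ (ι : Type u) (_ : Countable ι) (τ : ι → TransversalBlocks X),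
      ∀ σ : ι → ℕ → ℕ, (∀ s, (σ s).Injective) → ∀ w ∈ V, w ∈ selectionInf τ σ → w = 0 := by
  induction r generalizing ι with
  | zero =>
    exact absurd linearIndependent_empty_type (h (fun _ => id)
      (fun _ => Function.injective_id) Fin.elim0 (fun j => j.elim0) (fun j => j.elim0))
  | succ r ih =>
    by_cases hτ : ∀ σ : ι → ℕ → ℕ, (∀ s, (σ s).Injective) →
        ∀ w ∈ V, w ∈ selectionInf τ σ → w = 0
    · exact ⟨ι, inferInstance, τ, hτ⟩
    push Not at hτ
    obtain ⟨σ₀, hσ₀, w, hwV, hw, hw0⟩ := hτ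
    obtain ⟨κ, _, τ', hτ'⟩ := exists_blocks_smul_mem_imp_eq_zero hD hwpb hX hbot hw0
    refine ih (ι := ι ⊕ κ) (Sum.elim (fun s => (τ s).thin (σ₀ s) (hσ₀ s)) τ') ?_
    intro σ hσ v hvT hvV hv
    have hleft : ∀ u ∈ selectionInf (Sum.elim (fun s => (τ s).thin (σ₀ s) (hσ₀ s)) τ') σ,
        u ∈ selectionInf τ fun s => σ₀ s ∘ σ (Sum.inl s) := fun u hu =>
      (Submodule.mem_iInf _).2 fun s => (Submodule.mem_iInf _).1 hu (Sum.inl s)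
    have hright : ∀ u ∈ selectionInf (Sum.elim (fun s => (τ s).thin (σ₀ s) (hσ₀ s)) τ') σ,
        u ∈ selectionInf τ' fun s => σ (Sum.inr s) := fun u hu =>
      (Submodule.mem_iInf _).2 fun s => (Submodule.mem_iInf _).1 hu (Sum.inr s)
    refine h (fun s => σ₀ s ∘ σ (Sum.inl s)) (fun s => (hσ₀ s).comp (hσ _))
      (Fin.cons w v) ?_ ?_ ?_
    · refine Fin.cases ?_ fun j => ?_
      · exact (Submodule.mem_iInf _).2 fun s =>
          (τ s).inf_le_inf_comp _ _ ((Submodule.mem_iInf _).1 hw s)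
      · exact hleft _ (hvT j)
    · exact Fin.cases hwV hvV
    · refine LinearIndependent.finCons' w v hv fun c y hy hc => ?_
      refine hτ' (fun s => σ (Sum.inr s)) (fun s => hσ _) c (hright _ ?_)
      rw [eq_neg_of_add_eq_zero_left hc]
      refine neg_mem ?_
      have hspan : Submodule.span D (Set.range v) ≤
          (selectionInf (Sum.elim (fun s => (τ s).thin (σ₀ s) (hσ₀ s)) τ') σ).restrictScalars
            D := by
        rw [Submodule.span_le]
        rintro _ ⟨j, rfl⟩
        exact hvT j
      exact hspan hy

theorem exists_blocks_disjoint_span [Module.IsTorsionFree D R]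
    (hD : ¬ ∃ (b : ℕ → Ideal D) (t : ℕ → D), ∀ m n, t n ∈ b m ↔ m ≠ n)
    (hwpb : WeaklyProductivelyBounded.{u, u, u} D) (hX : ∀ i, (X i).Nonempty)
    (hbot : ∀ J : Set I, Jᶜ.Finite → sInf (⋃ i ∈ J, X i) = ⊥) (F : Finset R) :
    ∃ (ι : Type u) (_ : Countable ι) (τ : ι → TransversalBlocks X),
      ∀ σ : ι → ℕ → ℕ, (∀ s, (σ s).Injective) →
        ∀ w ∈ Submodule.span D (F : Set R), w ∈ selectionInf τ σ → w = 0 := by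
  refine exists_blocks_disjoint_of_not_linearIndependent hD hwpb hX hbot _ (F.card + 1)
    (ι := PEmpty) (fun s => s.elim) fun σ hσ v _ hv hlin => ?_
  have := linearIndependent_le_span_aux' v hlin (F : Set R) (by
    rintro _ ⟨j, rfl⟩
    exact hv j)
  simp at this

theorem exists_selection_pairwise_disjoint {ι I : Type*} [Countable ι] (G : ι → ℕ → Finset I)
    (hG : ∀ s, Pairwise fun m n => Disjoint (G s m) (G s n)) :
    ∃ σ : ι → ℕ → ℕ, (∀ s, (σ s).Injective) ∧
      Pairwise fun p q : ι × ℕ => Disjoint (G p.1 (σ p.1 p.2)) (G q.1 (σ q.1 q.2)) := by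
  classical
  rcases isEmpty_or_nonempty ι with _ | _
  · exact ⟨fun s => isEmptyElim s, fun s => isEmptyElim s, fun p => isEmptyElim p.1⟩
  obtain ⟨g, hg⟩ := exists_surjective_nat (ι × ℕ)
  have step : ∀ (k : ℕ) (U : Finset I × ℕ), ∃ m, U.2 ≤ m ∧ Disjoint (G (g k).1 m) U.1 :=
    fun k U => ((Filter.eventually_ge_atTop U.2).and
      (eventually_disjoint_of_pairwise_disjoint (hG (g k).1) U.1)).exists
  choose m hm hdisj using step
  let U : ℕ → Finset I × ℕ := fun k => Nat.rec (∅, 0)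
    (fun k V => (V.1 ∪ G (g k).1 (m k V), m k V + 1)) k
  have hU : ∀ k, U (k + 1) = ((U k).1 ∪ G (g k).1 (m k (U k)), m k (U k) + 1) := fun _ => rfl
  have hmono : Monotone U := monotone_nat_of_le_succ fun k => by
    rw [hU]
    exact ⟨Finset.subset_union_left, (hm k (U k)).trans (Nat.le_succ _)⟩
  have hlt : ∀ j k, j < k → m j (U j) < m k (U k) ∧
      Disjoint (G (g k).1 (m k (U k))) (G (g j).1 (m j (U j))) := fun j k hjk => by
    have h := hmono (Nat.succ_le_of_lt hjk)
    rw [Nat.succ_eq_add_one, hU] at h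
    exact ⟨h.2.trans (hm k _), (hdisj k (U k)).mono_right (Finset.subset_union_right.trans h.1)⟩
  have hgk : ∀ p, g (Function.surjInv hg p) = p := Function.surjInv_eq hg
  refine ⟨fun s n => m (Function.surjInv hg (s, n)) (U (Function.surjInv hg (s, n))),
    fun s n n' h => ?_, fun p q hpq => ?_⟩
  · have hk : Function.surjInv hg (s, n) = Function.surjInv hg (s, n') := by
      by_contra hne
      rcases lt_or_gt_of_ne hne with h' | h'
      · exact (hlt _ _ h').1.ne h
      · exact (hlt _ _ h').1.ne h.symm
    exact (Prod.ext_iff.1 (Function.injective_surjInv hg hk)).2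
  · have hne := (Function.injective_surjInv hg).ne hpq
    rcases lt_or_gt_of_ne hne with h' | h'
    · have := (hlt _ _ h').2
      rw [hgk, hgk] at this
      exact this.symm
    · have := (hlt _ _ h').2
      rwa [hgk, hgk] at this

theorem exists_transversal_le_selectionInf (hX : ∀ i, (X i).Nonempty) {ι : Type*} [Countable ι]
    (τ : ι → TransversalBlocks X) :
    ∃ A : I → Ideal R, (∀ i, A i ∈ X i) ∧
      ∃ σ : ι → ℕ → ℕ, (∀ s, (σ s).Injective) ∧ (⨅ i, A i) ≤ selectionInf τ σ := by
  classical
  obtain ⟨σ, hσ, hdisj⟩ := exists_selection_pairwise_disjoint (fun s => (τ s).block)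
    fun s => (τ s).disjoint
  have hA : ∀ i, ∃ A ∈ X i, ∀ s n, i ∈ (τ s).block (σ s n) → A = (τ s).ideal i := by
    intro i
    by_cases h : ∃ s n, i ∈ (τ s).block (σ s n)
    · obtain ⟨s, n, hsn⟩ := h
      refine ⟨(τ s).ideal i, (τ s).mem i, fun s' n' h' => ?_⟩
      have : (s, n) = (s', n') := by
        by_contra hne
        exact Finset.disjoint_left.1 (hdisj hne) hsn h'
      cases this
      rfl
    · obtain ⟨A, hA⟩ := hX i
      exact ⟨A, hA, fun s n hs => absurd ⟨s, n, hs⟩ h⟩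
  choose A hAX hA using hA
  refine ⟨A, hAX, σ, hσ, ?_⟩
  refine le_iInf fun s => le_iInf fun n => le_iInf₂ fun i hi => ?_
  rw [← hA i s n hi]
  exact iInf_le _ i

end Selection

theorem exists_finset_mem_span_of_closure_eq_top {R : Type*} [CommRing R] {D : Subring R}
    {x : ℕ → R} (hgen : Subring.closure (↑D ∪ Set.range x) = ⊤) :
    ∃ F : Finset (ℕ →₀ ℕ) → Finset R, ∀ y : R, ∃ s, y ∈ Submodule.span D (F s : Set R) := by
  classical
  have htop : Algebra.adjoin D (Set.range x) = ⊤ := by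
    refine eq_top_iff.2 fun y _ => ?_
    have hle : Subring.closure (↑D ∪ Set.range x) ≤
        (Algebra.adjoin D (Set.range x)).toSubring := by
      rw [Subring.closure_le]
      rintro z (hz | hz)
      · exact (Algebra.adjoin D (Set.range x)).algebraMap_mem ⟨z, hz⟩
      · exact Algebra.subset_adjoin hz
    exact hle (hgen ▸ Subring.mem_top y)
  refine ⟨fun s => s.image fun e => MvPolynomial.aeval x (MvPolynomial.monomial e (1 : D)),
    fun y => ?_⟩
  have hy : y ∈ (MvPolynomial.aeval x : MvPolynomial ℕ D →ₐ[D] R).range := by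
    rw [← Algebra.adjoin_range_eq_range_aeval, htop]
    exact Algebra.mem_top
  obtain ⟨p, rfl⟩ := hy
  refine ⟨p.support, ?_⟩
  rw [AlgHom.toRingHom_eq_coe, RingHom.coe_coe, congrArg (MvPolynomial.aeval x) p.as_sum, map_sum]
  refine Submodule.sum_mem _ fun e he => ?_
  rw [← mul_one (p.coeff e), ← smul_eq_mul, ← MvPolynomial.smul_monomial, map_smul]
  exact Submodule.smul_mem _ _ (Submodule.subset_span (Finset.mem_coe.2
    (Finset.mem_image_of_mem _ he)))

/-- Suppose `D` is a subring of the commutative integral domain `R` such that `R` is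
countably generated over `D` as a ring, and suppose the lattice of ideals of `D` contains
no subset order-isomorphic to the power set of `ℕ` (this holds whenever `D` has Krull
dimension in the sense of Gordon and Robson).  If `D` is weakly productively bounded,
then the dual ideal lattice `L_R` of `R` is uniformly transversally bounded. -/
theorem idealUTB_of_wPB_krull_subring
    (R : Type u) [CommRing R] [IsDomain R] (D : Subring R) (x : ℕ → R)
    (hgen : Subring.closure (↑D ∪ Set.range x) = ⊤)
    (hD : ¬ ∃ f : Set ℕ → Ideal ↥D, Function.Injective f ∧
      ∀ A B : Set ℕ, A ⊆ B ↔ f A ≤ f B)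
    (hwpb : WeaklyProductivelyBounded.{u, u, u} ↥D) :
    IdealUTB.{u, v} R := by
  intro I X hX htrans
  by_contra! hbot
  have hindep : ¬ ∃ (b : ℕ → Ideal D) (t : ℕ → D), ∀ m n, t n ∈ b m ↔ m ≠ n :=
    fun ⟨_, _, h⟩ => hD (exists_powerset_embedding_of_mem_iff_ne h)
  obtain ⟨F, hF⟩ := exists_finset_mem_span_of_closure_eq_top hgen
  choose ι hι τ hτ using fun s => exists_blocks_disjoint_span hindep hwpb hX hbot (F s)
  obtain ⟨A, hA, σ, hσ, hle⟩ := exists_transversal_le_selectionInf hX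
    fun p : Σ s, ι s => τ p.1 p.2
  refine htrans A hA ((Submodule.eq_bot_iff _).2 fun y hy => ?_)
  obtain ⟨s, hs⟩ := hF y
  exact hτ s (fun k => σ ⟨s, k⟩) (fun k => hσ _) y hs
    ((Submodule.mem_iInf _).2 fun k => (Submodule.mem_iInf _).1 (hle hy) ⟨s, k⟩)
end
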